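/- There exists a compact set K ⊆ Γ which is both a Kronecker set and a Carleson set such that J₀⁺(K) is properly contained in I⁺(K), and moreover there are 2^{ℵ₀} distinct closed ideals I of A⁺ with J₀⁺(K) ⊆ I ⊆ I⁺(K). -/

import Mathlib

noncomputable section

/-- An invertible contraction on a (complex) Banach space. -/
structure BanachContraction where
  X : Type
  [grp : NormedAddCommGroup X]
  [mod : NormedSpace ℂ X]
  [cpl : CompleteSpace X]
  T : X →L[ℂ] X
  Tinv : X →L[ℂ] X
  norm_le : ‖T‖ ≤ 1
  mul_inv : T * Tinv = 1
  inv_mul : Tinv * T = 1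

attribute [instance] BanachContraction.grp BanachContraction.mod BanachContraction.cpl

open Complex MeasureTheory Metric Set Filter

/-- The `n`-th Taylor coefficient of `f` at `0`, i.e. `f⁽ⁿ⁾(0)/n!`. -/
def taylorCoeff (f : ℂ → ℂ) (n : ℕ) : ℂ := iteratedDeriv n f 0 / (n.factorial : ℂ)

/-- `A⁺`, the algebra of absolutely convergent Taylor series: functions which, on the
closed unit disk, are sums of a power series with absolutely summable coefficients. -/
def APlus : Set (ℂ → ℂ) :=
  {f | ∃ a : ℕ → ℂ, Summable (fun n => ‖a n‖) ∧
    ∀ z ∈ Metric.closedBall (0 : ℂ) 1, HasSum (fun n => a n * z ^ n) (f z)}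

/-- The norm `‖f‖₁ = ∑ₙ |f⁽ⁿ⁾(0)/n!|` on `A⁺`. -/
def APlusNorm (f : ℂ → ℂ) : ℝ := ∑' n : ℕ, ‖taylorCoeff f n‖

/-- The `n`-th Fourier coefficient of (the boundary values of) `f` on the unit circle. -/
def fcoeff (f : ℂ → ℂ) (n : ℤ) : ℂ :=
  (1 / (2 * Real.pi)) * ∫ θ in (0:ℝ)..(2 * Real.pi),
    f (Complex.exp ((θ : ℂ) * Complex.I)) * Complex.exp (-(n : ℂ) * (θ : ℂ) * Complex.I)

/-- The Wiener algebra `A(Γ)` of absolutely convergent Fourier series on the unit circle,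
viewed as functions `ℂ → ℂ` (only the values on the unit circle are relevant). -/
def WienerAlg : Set (ℂ → ℂ) :=
  {f | Summable (fun n : ℤ => ‖fcoeff f n‖) ∧
    ∀ z ∈ Metric.sphere (0 : ℂ) 1, HasSum (fun n : ℤ => fcoeff f n * z ^ n) (f z)}

/-- The norm `‖f‖₁ = ∑_{n ∈ ℤ} |f̂(n)|` on `A(Γ)`. -/
def WienerNorm (f : ℂ → ℂ) : ℝ := ∑' n : ℤ, ‖fcoeff f n‖

/-- `I` is a closed ideal of `A⁺` (closedness w.r.t. the norm `APlusNorm`). -/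
def IsClosedIdealAPlus (I : Set (ℂ → ℂ)) : Prop :=
  I ⊆ APlus ∧
  (∀ f ∈ I, ∀ g ∈ I, f + g ∈ I) ∧
  (∀ f ∈ APlus, ∀ g ∈ I, f * g ∈ I) ∧
  (∀ f ∈ APlus, (∀ ε > 0, ∃ g ∈ I, APlusNorm (f - g) < ε) → f ∈ I)

/-- `J` is a closed ideal of the Wiener algebra `A(Γ)`. -/
def IsClosedIdealW (J : Set (ℂ → ℂ)) : Prop :=
  J ⊆ WienerAlg ∧
  (∀ f ∈ J, ∀ g ∈ J, f + g ∈ J) ∧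
  (∀ f ∈ WienerAlg, ∀ g ∈ J, f * g ∈ J) ∧
  (∀ f ∈ WienerAlg, (∀ ε > 0, ∃ g ∈ J, WienerNorm (f - g) < ε) → f ∈ J)

/-- `I^A` : the closed ideal generated by `I` in the Wiener algebra `A(Γ)`. -/
def IdealGenW (I : Set (ℂ → ℂ)) : Set (ℂ → ℂ) := ⋂₀ {J | IsClosedIdealW J ∧ I ⊆ J}

/-- The hull `h(I)`: common zeros in the closed unit disk of all elements of `I`. -/
def hull (I : Set (ℂ → ℂ)) : Set ℂ :=
  {z ∈ Metric.closedBall (0 : ℂ) 1 | ∀ f ∈ I, f z = 0}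

/-- `I ≠ {0}`: `I` contains an element not identically zero on the unit disk. -/
def NontrivialIdeal (I : Set (ℂ → ℂ)) : Prop :=
  ∃ f ∈ I, ∃ z ∈ Metric.ball (0 : ℂ) 1, f z ≠ 0

/-- `H^∞(D)`: bounded holomorphic functions on the open unit disk. -/
def Hinf : Set (ℂ → ℂ) :=
  {f | DifferentiableOn ℂ f (Metric.ball (0 : ℂ) 1) ∧
    ∃ C : ℝ, ∀ z ∈ Metric.ball (0 : ℂ) 1, ‖f z‖ ≤ C}

/-- An inner function: a bounded-by-one holomorphic function on the unit disk whose
radial limits have modulus `1` at almost every boundary point. -/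
def IsInnerFunction (u : ℂ → ℂ) : Prop :=
  DifferentiableOn ℂ u (Metric.ball (0 : ℂ) 1) ∧
  (∀ z ∈ Metric.ball (0 : ℂ) 1, ‖u z‖ ≤ 1) ∧
  ∀ᵐ (θ : ℝ) ∂(MeasureTheory.volume.restrict (Set.Ioc (0 : ℝ) (2 * Real.pi))),
    Filter.Tendsto (fun r : ℝ => ‖u ((r : ℂ) * Complex.exp ((θ : ℂ) * Complex.I))‖)
      (nhdsWithin 1 (Set.Iio 1)) (nhds 1)

/-- `S` divides (the inner factor of) `f`, i.e. `f ∈ S·H^∞`. -/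
def InnerDivides (S f : ℂ → ℂ) : Prop :=
  ∃ g ∈ Hinf, ∀ z ∈ Metric.ball (0 : ℂ) 1, f z = S z * g z

/-- `S` is a greatest common divisor of the inner factors of the nonzero elements of `I`:
`S` is inner, divides every nonzero element of `I`, and every inner function with this
property divides `S`. -/
def IsGcdInner (I : Set (ℂ → ℂ)) (S : ℂ → ℂ) : Prop :=
  IsInnerFunction S ∧
  (∀ f ∈ I, (∃ z ∈ Metric.ball (0 : ℂ) 1, f z ≠ 0) → InnerDivides S f) ∧
  ∀ S' : ℂ → ℂ, IsInnerFunction S' →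
    (∀ f ∈ I, (∃ z ∈ Metric.ball (0 : ℂ) 1, f z ≠ 0) → InnerDivides S' f) →
    InnerDivides S' S

/-- The perfect symmetric set `E_ξ` of constant ratio `ξ` on the unit circle. -/
def Eset (ξ : ℝ) : Set ℂ :=
  {z | ∃ ε : ℕ → ℕ, (∀ k, ε k ≤ 1) ∧
    z = Complex.exp (2 * Real.pi * Complex.I *
      (((1 - ξ) * ∑' k : ℕ, (ε k : ℝ) * ξ ^ k : ℝ) : ℂ))}

/-- A Carleson set: a closed subset of the unit circle with
`∫_{-π}^{π} log (2 / dist(e^{iθ}, E)) dθ < ∞`. -/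
def IsCarleson (E : Set ℂ) : Prop :=
  IsClosed E ∧ E ⊆ Metric.sphere (0 : ℂ) 1 ∧
  MeasureTheory.IntegrableOn
    (fun θ : ℝ => Real.log (2 / Metric.infDist (Complex.exp ((θ : ℂ) * Complex.I)) E))
    (Set.Ioc (-Real.pi) Real.pi)

/-- The division ideal `I(f) = {g ∈ A⁺ : fg ∈ I}`. -/
def Idiv (I : Set (ℂ → ℂ)) (f : ℂ → ℂ) : Set (ℂ → ℂ) := {g ∈ APlus | f * g ∈ I}

/-- `f` belongs to `A^∞(D)` and vanishes on `E` together with all its derivatives: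
`f` is holomorphic on the disk, and each derivative extends continuously to the closed
disk with the extension vanishing on `E`. -/
def VanishAllDeriv (E : Set ℂ) (f : ℂ → ℂ) : Prop :=
  ContinuousOn f (Metric.closedBall (0 : ℂ) 1) ∧
  DifferentiableOn ℂ f (Metric.ball (0 : ℂ) 1) ∧
  (∀ z ∈ E, f z = 0) ∧
  ∀ n : ℕ, ∃ g : ℂ → ℂ, ContinuousOn g (Metric.closedBall (0 : ℂ) 1) ∧
    Set.EqOn g (iteratedDeriv n f) (Metric.ball (0 : ℂ) 1) ∧ ∀ z ∈ E, g z = 0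

/-- `J₀⁺(E)`: the closure in `A⁺` of the set of elements of `A^∞(D)` vanishing on `E`
together with all their derivatives. -/
def J0Plus (E : Set ℂ) : Set (ℂ → ℂ) :=
  {f | f ∈ APlus ∧ ∀ ε > 0, ∃ g ∈ APlus, VanishAllDeriv E g ∧ APlusNorm (f - g) < ε}

/-- `I⁺(E) = {f ∈ A⁺ : f ≡ 0 on E}`. -/
def IPlus (E : Set ℂ) : Set (ℂ → ℂ) := {f ∈ APlus | ∀ z ∈ E, f z = 0}

/-- The pairing of `f ∈ A⁺ ≅ ℓ¹(ℕ)` with an element `c ∈ c₀`. -/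
def pairing (f : ℂ → ℂ) (c : ℕ → ℂ) : ℂ := ∑' n : ℕ, taylorCoeff f n * c n

/-- `S` is dense in `A⁺` for the weak-star topology `σ(ℓ¹, c₀)`. -/
def WStarDense (S : Set (ℂ → ℂ)) : Prop :=
  ∀ f ∈ APlus, ∀ (m : ℕ) (c : Fin m → ℕ → ℂ),
    (∀ i, Filter.Tendsto (c i) Filter.atTop (nhds 0)) →
    ∀ ε > 0, ∃ g ∈ S, ∀ i, ‖pairing f (c i) - pairing g (c i)‖ < ε

/-- `S` is closed in `A⁺` for the weak-star topology `σ(ℓ¹, c₀)`. -/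
def WStarClosed (S : Set (ℂ → ℂ)) : Prop :=
  S ⊆ APlus ∧
  ∀ f ∈ APlus,
    (∀ (m : ℕ) (c : Fin m → ℕ → ℂ),
      (∀ i, Filter.Tendsto (c i) Filter.atTop (nhds 0)) →
      ∀ ε > 0, ∃ g ∈ S, ∀ i, ‖pairing f (c i) - pairing g (c i)‖ < ε) → f ∈ S

/-- A Kronecker set: a compact subset of the unit circle on which every continuous
unimodular function is a uniform limit of characters `z ↦ zⁿ`, `n ∈ ℤ`. -/
def IsKronecker (K : Set ℂ) : Prop :=
  IsCompact K ∧ K ⊆ Metric.sphere (0 : ℂ) 1 ∧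
  ∀ f : ℂ → ℂ, ContinuousOn f K → (∀ z ∈ K, ‖f z‖ = 1) →
    ∀ ε > 0, ∃ n : ℤ, ∀ z ∈ K, ‖f z - z ^ n‖ < ε

/-- A Helson set: a compact subset of the unit circle on which every continuous function
is the restriction of an element of the Wiener algebra. -/
def IsHelson (K : Set ℂ) : Prop :=
  IsCompact K ∧ K ⊆ Metric.sphere (0 : ℂ) 1 ∧
  ∀ f : ℂ → ℂ, ContinuousOn f K → ∃ g ∈ WienerAlg, ∀ z ∈ K, f z = g z

/-- The little Lipschitz class `Λ_α(D)`: disc-algebra functions with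
`|f(e^{it₁}) - f(e^{it₂})| / |t₁-t₂|^α → 0` uniformly as `|t₁-t₂| → 0`. -/
def LittleLip (α : ℝ) (f : ℂ → ℂ) : Prop :=
  ContinuousOn f (Metric.closedBall (0 : ℂ) 1) ∧
  DifferentiableOn ℂ f (Metric.ball (0 : ℂ) 1) ∧
  ∀ ε > 0, ∃ δ > 0, ∀ t₁ t₂ : ℝ, t₁ ≠ t₂ → |t₁ - t₂| < δ →
    ‖f (Complex.exp ((t₁ : ℂ) * Complex.I)) - f (Complex.exp ((t₂ : ℂ) * Complex.I))‖ ≤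
      ε * |t₁ - t₂| ^ α

/-- The perfect part of a set: the union of all its perfect subsets. -/
def perfectPart (C : Set ℂ) : Set ℂ := ⋃₀ {P | Perfect P ∧ P ⊆ C}

/-- A distribution on the unit circle, encoded by its sequence of Fourier coefficients
`μ̂(n) = μ(e^{-int})`, which has polynomial growth. -/
structure CircleDistribution where
  coeff : ℤ → ℂ
  growth : ∃ (C : ℝ) (k : ℕ), ∀ n : ℤ, ‖coeff n‖ ≤ C * (1 + (n.natAbs : ℝ)) ^ k

/-- A smooth `2π`-periodic function (test function on the circle). -/
def PeriodicSmooth (φ : ℝ → ℂ) : Prop :=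
  ContDiff ℝ (⊤ : ℕ∞) φ ∧ ∀ θ : ℝ, φ (θ + 2 * Real.pi) = φ θ

/-- Fourier coefficients of a test function. -/
def testCoeff (φ : ℝ → ℂ) (n : ℤ) : ℂ :=
  (1 / (2 * Real.pi)) * ∫ θ in (0:ℝ)..(2 * Real.pi),
    φ θ * Complex.exp (-(n : ℂ) * (θ : ℂ) * Complex.I)

/-- The action of a distribution on a test function: `μ(φ) = ∑ₙ μ̂(n) φ̂(-n)`. -/
def distAct (μ : CircleDistribution) (φ : ℝ → ℂ) : ℂ := ∑' n : ℤ, μ.coeff n * testCoeff φ (-n)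

/-- The support of a distribution on the circle: the points of the circle having no open
neighbourhood `U` such that `μ` kills every test function supported in `U`. -/
def distSupport (μ : CircleDistribution) : Set ℂ :=
  {z ∈ Metric.sphere (0 : ℂ) 1 | ∀ U : Set ℂ, IsOpen U → z ∈ U →
    ∃ φ : ℝ → ℂ, PeriodicSmooth φ ∧
      (∀ θ : ℝ, Complex.exp ((θ : ℂ) * Complex.I) ∉ U → φ θ = 0) ∧ distAct μ φ ≠ 0}

/-- A set of multiplicity: a closed subset of the circle supporting a nonzero
pseudofunction (distribution whose Fourier coefficients tend to `0` as `|n| → ∞`). -/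
def IsMSet (E : Set ℂ) : Prop :=
  IsClosed E ∧ E ⊆ Metric.sphere (0 : ℂ) 1 ∧
  ∃ μ : CircleDistribution, μ.coeff ≠ 0 ∧ distSupport μ ⊆ E ∧
    Filter.Tendsto μ.coeff Filter.cofinite (nhds 0)

/-- A Dirichlet set: `sup_{z ∈ E} |z^{n_k} - 1| → 0` for some sequence `n_k → ∞`. -/
def IsDirichletSet (E : Set ℂ) : Prop :=
  ∃ n : ℕ → ℕ, Filter.Tendsto n Filter.atTop Filter.atTop ∧
    ∀ ε > 0, ∀ᶠ k in Filter.atTop, ∀ z ∈ E, ‖z ^ (n k) - 1‖ < ε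



/-- `f` is, on the closed unit disk, the sum of the absolutely convergent Taylor series with
coefficients `a`. -/
def HasTaylor (f : ℂ → ℂ) (a : ℕ → ℂ) : Prop :=
  Summable (fun n => ‖a n‖) ∧
    ∀ z ∈ Metric.closedBall (0 : ℂ) 1, HasSum (fun n => a n * z ^ n) (f z)

theorem HasTaylor.mem {f : ℂ → ℂ} {a : ℕ → ℂ} (h : HasTaylor f a) : f ∈ APlus := ⟨a, h⟩

theorem HasTaylor.taylorCoeff_eq {f : ℂ → ℂ} {a : ℕ → ℂ} (h : HasTaylor f a) :
    taylorCoeff f = a := by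
  have h1 : HasFPowerSeriesAt f (FormalMultilinearSeries.ofScalars ℂ a) 0 := by
    rw [hasFPowerSeriesAt_iff]
    filter_upwards [Metric.closedBall_mem_nhds (0 : ℂ) one_pos] with z hz
    simpa [mul_comm, FormalMultilinearSeries.coeff_ofScalars] using h.2 z hz
  have h2 := h1.analyticAt.hasFPowerSeriesAt
  have h3 := h1.eq_formalMultilinearSeries h2
  rw [FormalMultilinearSeries.ofScalars_series_eq_iff] at h3
  exact h3.symm

theorem HasTaylor.norm_eq {f : ℂ → ℂ} {a : ℕ → ℂ} (h : HasTaylor f a) :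
    APlusNorm f = ∑' n, ‖a n‖ := by
  rw [APlusNorm, h.taylorCoeff_eq]

theorem hasTaylor_of_mem {f : ℂ → ℂ} (h : f ∈ APlus) : HasTaylor f (taylorCoeff f) := by
  obtain ⟨a, ha⟩ := h
  have h1 : HasTaylor f a := ha
  rwa [h1.taylorCoeff_eq]

theorem APlusNorm_nonneg (f : ℂ → ℂ) : 0 ≤ APlusNorm f := tsum_nonneg fun _ => norm_nonneg _

theorem norm_le_APlusNorm {f : ℂ → ℂ} (hf : f ∈ APlus) {z : ℂ} (hz : ‖z‖ ≤ 1) :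
    ‖f z‖ ≤ APlusNorm f := by
  have h := hasTaylor_of_mem hf
  rw [← (h.2 z (by simpa using hz)).tsum_eq]
  refine tsum_of_norm_bounded h.1.hasSum fun n => ?_
  rw [norm_mul, norm_pow]
  exact mul_le_of_le_one_right (norm_nonneg _) (pow_le_one₀ (norm_nonneg _) hz)

theorem continuousOn_of_mem_APlus {f : ℂ → ℂ} (hf : f ∈ APlus) :
    ContinuousOn f (closedBall 0 1) := by
  have h := hasTaylor_of_mem hf
  have : ContinuousOn (fun z => ∑' n, taylorCoeff f n * z ^ n) (closedBall 0 1) := by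
    refine continuousOn_tsum (fun n => by fun_prop) h.1 fun n z hz => ?_
    rw [norm_mul, norm_pow]
    exact mul_le_of_le_one_right (norm_nonneg _)
      (pow_le_one₀ (norm_nonneg _) (by simpa using hz))
  exact this.congr fun z hz => (h.2 z hz).tsum_eq.symm

theorem HasTaylor.add {f g : ℂ → ℂ} {a b : ℕ → ℂ} (hf : HasTaylor f a) (hg : HasTaylor g b) :
    HasTaylor (f + g) (a + b) := by
  refine ⟨.of_nonneg_of_le (fun _ => norm_nonneg _) (fun n => norm_add_le _ _)
    (hf.1.add hg.1), fun z hz => ?_⟩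
  simpa [add_mul] using (hf.2 z hz).add (hg.2 z hz)

theorem HasTaylor.const_mul {f : ℂ → ℂ} {a : ℕ → ℂ} (hf : HasTaylor f a) (c : ℂ) :
    HasTaylor (fun z => c * f z) (fun n => c * a n) := by
  refine ⟨by simpa using hf.1.mul_left ‖c‖, fun z hz => ?_⟩
  simpa [mul_assoc] using (hf.2 z hz).mul_left c

theorem HasTaylor.mul {f g : ℂ → ℂ} {a b : ℕ → ℂ} (hf : HasTaylor f a) (hg : HasTaylor g b) :
    HasTaylor (f * g) (fun n => ∑ kl ∈ Finset.HasAntidiagonal.antidiagonal n, a kl.1 * b kl.2) := by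
  refine ⟨summable_norm_sum_mul_antidiagonal_of_summable_norm hf.1 hg.1, fun z hz => ?_⟩
  have hz' : ‖z‖ ≤ 1 := by simpa using hz
  have key : ∀ {c : ℕ → ℂ}, Summable (fun n => ‖c n‖) → Summable fun n => ‖c n * z ^ n‖ := by
    intro c hc
    refine .of_nonneg_of_le (fun _ => norm_nonneg _) (fun n => ?_) hc
    rw [norm_mul, norm_pow]
    exact mul_le_of_le_one_right (norm_nonneg _) (pow_le_one₀ (norm_nonneg _) hz')
  have h1 := tsum_mul_tsum_eq_tsum_sum_antidiagonal_of_summable_norm (key hf.1) (key hg.1)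
  have h2 := (summable_norm_sum_mul_antidiagonal_of_summable_norm (key hf.1) (key hg.1)).of_norm
  rw [(hf.2 z hz).tsum_eq, (hg.2 z hz).tsum_eq] at h1
  rw [Pi.mul_apply, h1]
  refine h2.hasSum.congr_fun fun n => ?_
  rw [Finset.sum_mul]
  refine Finset.sum_congr rfl fun kl hkl => ?_
  rw [← Finset.HasAntidiagonal.mem_antidiagonal.mp hkl]
  ring

theorem add_mem_APlus {f g : ℂ → ℂ} (hf : f ∈ APlus) (hg : g ∈ APlus) : f + g ∈ APlus :=
  ((hasTaylor_of_mem hf).add (hasTaylor_of_mem hg)).mem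

theorem mul_mem_APlus {f g : ℂ → ℂ} (hf : f ∈ APlus) (hg : g ∈ APlus) : f * g ∈ APlus :=
  ((hasTaylor_of_mem hf).mul (hasTaylor_of_mem hg)).mem

theorem const_mul_mem_APlus {f : ℂ → ℂ} (hf : f ∈ APlus) (c : ℂ) :
    (fun z => c * f z) ∈ APlus := ((hasTaylor_of_mem hf).const_mul c).mem

theorem sub_mem_APlus {f g : ℂ → ℂ} (hf : f ∈ APlus) (hg : g ∈ APlus) : f - g ∈ APlus := by
  convert add_mem_APlus hf (const_mul_mem_APlus hg (-1)) using 1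
  ext z
  simp [sub_eq_add_neg]

theorem APlusNorm_add_le {f g : ℂ → ℂ} (hf : f ∈ APlus) (hg : g ∈ APlus) :
    APlusNorm (f + g) ≤ APlusNorm f + APlusNorm g := by
  have h1 := hasTaylor_of_mem hf
  have h2 := hasTaylor_of_mem hg
  rw [(h1.add h2).norm_eq, h1.norm_eq, h2.norm_eq, ← h1.1.tsum_add h2.1]
  exact (h1.add h2).1.tsum_le_tsum (fun n => norm_add_le _ _) (h1.1.add h2.1)

theorem APlusNorm_const_mul {f : ℂ → ℂ} (hf : f ∈ APlus) (c : ℂ) :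
    APlusNorm (fun z => c * f z) = ‖c‖ * APlusNorm f := by
  have h1 := hasTaylor_of_mem hf
  rw [(h1.const_mul c).norm_eq, h1.norm_eq, ← tsum_mul_left]
  simp

theorem APlusNorm_mul_le {f g : ℂ → ℂ} (hf : f ∈ APlus) (hg : g ∈ APlus) :
    APlusNorm (f * g) ≤ APlusNorm f * APlusNorm g := by
  have h1 := hasTaylor_of_mem hf
  have h2 := hasTaylor_of_mem hg
  have h1' : Summable fun n => ‖(‖taylorCoeff f n‖)‖ := by simpa using h1.1
  have h2' : Summable fun n => ‖(‖taylorCoeff g n‖)‖ := by simpa using h2.1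
  rw [(h1.mul h2).norm_eq, h1.norm_eq, h2.norm_eq,
    tsum_mul_tsum_eq_tsum_sum_antidiagonal_of_summable_norm h1' h2']
  refine (h1.mul h2).1.tsum_le_tsum (fun n => ?_)
    (summable_norm_sum_mul_antidiagonal_of_summable_norm h1' h2').of_norm
  exact (norm_sum_le _ _).trans (Finset.sum_le_sum fun kl _ => (norm_mul _ _).le)

theorem hasTaylor_pow (n : ℕ) : HasTaylor (fun z => z ^ n) (fun k => if k = n then 1 else 0) := by
  refine ⟨summable_of_hasFiniteSupport ((Set.finite_singleton n).subset fun k hk => ?_),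
    fun z _ => ?_⟩
  · by_contra h
    simp_all
  · convert hasSum_single (f := fun k => (if k = n then (1 : ℂ) else 0) * z ^ k) n ?_ using 1
    · simp
    · intro b hb
      simp [hb]

theorem pow_mem_APlus (n : ℕ) : (fun z : ℂ => z ^ n) ∈ APlus := (hasTaylor_pow n).mem

theorem APlusNorm_pow (n : ℕ) : APlusNorm (fun z : ℂ => z ^ n) = 1 := by
  rw [(hasTaylor_pow n).norm_eq, tsum_eq_single n]
  · simp
  · intro b hb
    simp [hb]

theorem const_mem_APlus (c : ℂ) : (fun _ : ℂ => c) ∈ APlus := by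
  simpa using const_mul_mem_APlus (pow_mem_APlus 0) c

theorem polynomial_mem_APlus (p : Polynomial ℂ) : (fun z : ℂ => p.eval z) ∈ APlus := by
  induction p using Polynomial.induction_on' with
  | add p q hp hq =>
    convert add_mem_APlus hp hq using 1
    ext z
    simp
  | monomial n a => simpa using const_mul_mem_APlus (pow_mem_APlus n) a

theorem tsum_mem_APlus {F : ℕ → ℂ → ℂ} (hF : ∀ k, F k ∈ APlus)
    (hs : Summable fun k => APlusNorm (F k)) :
    (fun z => ∑' k, F k z) ∈ APlus ∧
      APlusNorm (fun z => ∑' k, F k z) ≤ ∑' k, APlusNorm (F k) := by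
  have h1 := fun k => hasTaylor_of_mem (hF k)
  have h2 : Summable fun p : ℕ × ℕ => ‖taylorCoeff (F p.1) p.2‖ := by
    rw [summable_prod_of_nonneg fun _ => norm_nonneg _]
    exact ⟨fun k => (h1 k).1, hs⟩
  have h3 : Summable fun p : ℕ × ℕ => ‖taylorCoeff (F p.2) p.1‖ := h2.prod_symm
  have h4 : HasTaylor (fun z => ∑' k, F k z) (fun n => ∑' k, taylorCoeff (F k) n) := by
    refine ⟨.of_nonneg_of_le (fun _ => norm_nonneg _)
      (fun n => norm_tsum_le_tsum_norm (h3.prod_factor n)) h3.prod, fun z hz => ?_⟩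
    have h5 : Summable fun p : ℕ × ℕ => taylorCoeff (F p.1) p.2 * z ^ p.2 := by
      refine .of_norm_bounded h2 fun p => ?_
      rw [norm_mul, norm_pow]
      exact mul_le_of_le_one_right (norm_nonneg _)
        (pow_le_one₀ (norm_nonneg _) (by simpa using hz))
    have h6 : ∑' k, F k z = ∑' p : ℕ × ℕ, taylorCoeff (F p.1) p.2 * z ^ p.2 := by
      rw [h5.tsum_prod]
      exact tsum_congr fun k => ((h1 k).2 z hz).tsum_eq.symm
    beta_reduce
    rw [h6]
    have h7 := h5.prod_symm
    have h8 := h7.hasSum.prod_fiberwise fun n => (h7.prod_factor n).hasSum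
    have h9 := (Equiv.prodComm ℕ ℕ).tsum_eq (fun p : ℕ × ℕ => taylorCoeff (F p.1) p.2 * z ^ p.2)
    rw [← h9]
    refine HasSum.congr_fun h8 fun n => ?_
    simp [tsum_mul_right]
  refine ⟨h4.mem, ?_⟩
  rw [h4.norm_eq]
  calc _ ≤ ∑' n, ∑' k, ‖taylorCoeff (F k) n‖ :=
        h4.1.tsum_le_tsum (fun n => norm_tsum_le_tsum_norm (h3.prod_factor n)) h3.prod
    _ = ∑' k, APlusNorm (F k) := by
        rw [← h3.tsum_prod' (fun n => h3.prod_factor n)]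
        exact ((Equiv.prodComm ℕ ℕ).tsum_eq
          (fun p : ℕ × ℕ => ‖taylorCoeff (F p.1) p.2‖)).trans h2.tsum_prod

/-- The point of `[0, 2/7]` with digits `x` in the perfect symmetric set of ratio `2/9`. -/
def cantorAngle (x : ℕ → Bool) : ℝ := ∑' k, (if x k then (2 / 9 : ℝ) ^ (k + 1) else 0)

theorem summable_cantorAngle (x : ℕ → Bool) :
    Summable fun k => (if x k then (2 / 9 : ℝ) ^ (k + 1) else 0) := by
  have h : Summable fun k : ℕ => (2 / 9 : ℝ) ^ (k + 1) :=
    (summable_nat_add_iff 1).2 (summable_geometric_of_lt_one (by norm_num) (by norm_num))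
  refine .of_nonneg_of_le (fun k => ?_) (fun k => ?_) h
  · split_ifs <;> positivity
  · split_ifs
    · exact le_rfl
    · positivity

theorem cantorAngle_nonneg (x : ℕ → Bool) : 0 ≤ cantorAngle x :=
  tsum_nonneg fun k => by split_ifs <;> positivity

theorem cantorAngle_eq (x : ℕ → Bool) :
    cantorAngle x = 2 / 9 * ((if x 0 then 1 else 0) + cantorAngle fun k => x (k + 1)) := by
  rw [cantorAngle, (summable_cantorAngle x).tsum_eq_zero_add, cantorAngle, mul_add, ← tsum_mul_left]
  congr 1
  · split_ifs <;> norm_num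
  · refine tsum_congr fun k => ?_
    split_ifs <;> ring

theorem cantorAngle_le (x : ℕ → Bool) : cantorAngle x ≤ 2 / 7 := by
  have h : HasSum (fun k : ℕ => (2 / 9 : ℝ) ^ (k + 1)) (2 / 7) := by
    have := (hasSum_geometric_of_lt_one (r := (2 / 9 : ℝ)) (by norm_num) (by norm_num)).mul_left
      (2 / 9 : ℝ)
    convert! this using 1
    · ext k; ring
    · norm_num
  rw [← h.tsum_eq]
  refine (summable_cantorAngle x).tsum_le_tsum (fun k => ?_) h.summable
  split_ifs
  · exact le_rfl
  · positivity

theorem abs_cantorAngle_sub_le {m : ℕ} : ∀ {x y : ℕ → Bool}, x ∈ PiNat.cylinder y m →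
    |cantorAngle x - cantorAngle y| ≤ 2 / 7 * (2 / 9) ^ m := by
  induction m with
  | zero =>
    intro x y _
    rw [abs_le]
    constructor <;>
      linarith [cantorAngle_nonneg x, cantorAngle_nonneg y, cantorAngle_le x, cantorAngle_le y]
  | succ m ih =>
    intro x y h
    have h0 : x 0 = y 0 := h 0 (by omega)
    have h1 : (fun k => x (k + 1)) ∈ PiNat.cylinder (fun k => y (k + 1)) m :=
      fun i hi => h (i + 1) (by omega)
    have h2 := ih h1
    rw [cantorAngle_eq x, cantorAngle_eq y, h0, ← mul_sub, add_sub_add_left_eq_sub, abs_mul,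
      abs_of_pos (by norm_num), pow_succ]
    linarith

theorem cantorAngle_injective : Function.Injective cantorAngle := by
  have key : ∀ n : ℕ, ∀ x y : ℕ → Bool, cantorAngle x = cantorAngle y → x n = y n := by
    intro n
    have h0 : ∀ x y : ℕ → Bool, cantorAngle x = cantorAngle y → x 0 = y 0 := by
      intro x y h
      rw [cantorAngle_eq x, cantorAngle_eq y] at h
      have h1 := cantorAngle_nonneg fun k => x (k + 1)
      have h2 := cantorAngle_nonneg fun k => y (k + 1)
      have h3 := cantorAngle_le fun k => x (k + 1)
      have h4 := cantorAngle_le fun k => y (k + 1)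
      rcases hx : x 0 <;> rcases hy : y 0 <;> simp [hx, hy] at h ⊢ <;> linarith
    induction n with
    | zero => exact h0
    | succ n ih =>
      intro x y h
      have h1 := h0 x y h
      rw [cantorAngle_eq x, cantorAngle_eq y, h1] at h
      exact ih (fun k => x (k + 1)) (fun k => y (k + 1)) (by linarith)
  exact fun x y h => funext fun n => key n x y h

theorem continuous_of_cylinder_bound {α : Type*} [PseudoMetricSpace α] {f : (ℕ → Bool) → α}
    (hf : ∀ (m : ℕ) (x y : ℕ → Bool), x ∈ PiNat.cylinder y m → dist (f x) (f y) ≤ (2 / 9) ^ m) :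
    Continuous f := by
  rw [continuous_iff_continuousAt]
  intro y
  rw [Metric.continuousAt_iff']
  intro ε hε
  obtain ⟨m, hm⟩ := exists_pow_lt_of_lt_one hε (by norm_num : (2 / 9 : ℝ) < 1)
  filter_upwards [(PiNat.isOpen_cylinder (fun _ => Bool) y m).mem_nhds (PiNat.self_mem_cylinder y m)]
    with x hx
  exact (hf m x y hx).trans_lt hm

/-- The parametrisation of a perfect symmetric subset of the unit circle by binary sequences. -/
def cantorPt (x : ℕ → Bool) : ℂ := exp (cantorAngle x * I)

theorem norm_cantorPt (x : ℕ → Bool) : ‖cantorPt x‖ = 1 := norm_exp_ofReal_mul_I _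

theorem norm_exp_mul_I_sub_le (s t : ℝ) : ‖exp (s * I) - exp (t * I)‖ ≤ |s - t| := by
  have h : exp (s * I) - exp (t * I) = exp (t * I) * (exp (I * (s - t : ℝ)) - 1) := by
    rw [mul_sub, ← exp_add]
    push_cast
    ring_nf
  rw [h, norm_mul, norm_exp_ofReal_mul_I, one_mul]
  exact Real.norm_exp_I_mul_ofReal_sub_one_le

theorem norm_cantorPt_sub_le {m : ℕ} {x y : ℕ → Bool} (h : x ∈ PiNat.cylinder y m) :
    ‖cantorPt x - cantorPt y‖ ≤ (2 / 9) ^ m := by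
  refine (norm_exp_mul_I_sub_le _ _).trans ((abs_cantorAngle_sub_le h).trans ?_)
  have : (0 : ℝ) < (2 / 9) ^ m := by positivity
  linarith

theorem continuous_cantorAngle : Continuous cantorAngle :=
  continuous_of_cylinder_bound fun m x y h => by
    rw [Real.dist_eq]
    have : (0 : ℝ) < (2 / 9) ^ m := by positivity
    linarith [abs_cantorAngle_sub_le h]

theorem continuous_cantorPt : Continuous cantorPt :=
  continuous_of_cylinder_bound fun m x y h => by
    rw [dist_eq_norm]
    exact norm_cantorPt_sub_le h

theorem cantorPt_injective : Function.Injective cantorPt := by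
  intro x y h
  apply cantorAngle_injective
  have h1 := congrArg Complex.arg h
  have hx : ∀ x, cantorAngle x ∈ Ioc (-Real.pi) Real.pi := fun x =>
    ⟨by linarith [cantorAngle_nonneg x, Real.pi_pos],
      by linarith [cantorAngle_le x, Real.pi_gt_three]⟩
  rwa [cantorPt, cantorPt, arg_exp_mul_I, arg_exp_mul_I,
    (toIocMod_eq_self _).2 (by rw [show -Real.pi + 2 * Real.pi = Real.pi by ring]; exact hx x),
    (toIocMod_eq_self _).2 (by rw [show -Real.pi + 2 * Real.pi = Real.pi by ring]; exact hx y)] at h1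

/-- Prepend a digit. -/
def cantorCons (b : Bool) (x : ℕ → Bool) : ℕ → Bool := fun n => Nat.casesOn n b x

theorem continuous_cantorCons (b : Bool) : Continuous (cantorCons b) := by
  refine continuous_pi fun n => ?_
  cases n with
  | zero => exact continuous_const
  | succ n => exact continuous_apply n

/-- The fair coin. -/
def fairCoin : Measure Bool := (2 : ENNReal)⁻¹ • (Measure.dirac false + Measure.dirac true)

instance : IsProbabilityMeasure fairCoin :=
  ⟨by simp [fairCoin, ENNReal.inv_two_add_inv_two]⟩

/-- The uniform measure on binary sequences. -/
def cantorMeasure : Measure (ℕ → Bool) := Measure.infinitePi fun _ => fairCoin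

instance : IsProbabilityMeasure cantorMeasure := by
  unfold cantorMeasure; infer_instance

theorem cantorMeasure_eq : cantorMeasure = (2 : ENNReal)⁻¹ •
    (cantorMeasure.map (cantorCons false) + cantorMeasure.map (cantorCons true)) := by
  symm
  classical
  refine Measure.eq_infinitePi _ fun s t ht => ?_
  set s' := s.preimage Nat.succ (Nat.succ_injective.injOn) with hs'
  have hm : ∀ b, Measurable (cantorCons b) := fun b => (continuous_cantorCons b).measurable
  have hb : MeasurableSet ((s : Set ℕ).pi t) :=
    MeasurableSet.pi s.countable_toSet fun i _ => ht i
  have h1 : ∀ b, cantorMeasure (cantorCons b ⁻¹' ((s : Set ℕ).pi t)) =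
      (if 0 ∈ s → b ∈ t 0 then 1 else 0) * ∏ k ∈ s', fairCoin (t (k + 1)) := by
    intro b
    split_ifs with h
    · rw [one_mul, ← Measure.infinitePi_pi (X := fun _ : ℕ => Bool) (μ := fun _ => fairCoin)
        (s := s') (t := fun k => t (k + 1)) (fun i _ => ht (i + 1))]
      change Measure.infinitePi _ _ = _
      congr 1
      ext x
      simp only [mem_preimage, Set.mem_pi, Finset.mem_coe, hs', Finset.mem_preimage]
      constructor
      · exact fun hx i hi => hx (i + 1) hi
      · intro hx i hi
        cases i with
        | zero => exact h hi
        | succ i => exact hx i hi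
    · rw [zero_mul]
      convert measure_empty (μ := cantorMeasure)
      rw [Set.eq_empty_iff_forall_notMem]
      exact fun x hx => h fun h0 => hx 0 h0
  have h2 : ∏ i ∈ s, fairCoin (t i) =
      (if 0 ∈ s then fairCoin (t 0) else 1) * ∏ k ∈ s', fairCoin (t (k + 1)) := by
    have h3 : ∏ k ∈ s', fairCoin (t (k + 1)) =
        ∏ i ∈ s'.map ⟨Nat.succ, Nat.succ_injective⟩, fairCoin (t i) := by
      rw [Finset.prod_map]; rfl
    have h4 : 0 ∉ s'.map ⟨Nat.succ, Nat.succ_injective⟩ := by simp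
    split_ifs with h0
    · rw [h3, ← Finset.prod_insert (f := fun i => fairCoin (t i)) h4]
      congr 1
      ext i
      cases i <;> simp [hs', h0]
    · rw [h3, one_mul]
      congr 1
      ext i
      cases i <;> simp [hs', h0]
  rw [h2, Measure.smul_apply, Measure.add_apply, Measure.map_apply (hm _) hb,
    Measure.map_apply (hm _) hb, h1, h1, ← add_mul, smul_eq_mul, ← mul_assoc]
  congr 1
  by_cases h0 : 0 ∈ s
  · simp [h0, fairCoin, Set.indicator_apply, Measure.dirac_apply' _ (ht 0), mul_add]
  · simp [h0, one_add_one_eq_two, ENNReal.inv_mul_cancel]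

theorem integrable_of_continuous_cantor {g : (ℕ → Bool) → ℂ} (hg : Continuous g)
    (μ : Measure (ℕ → Bool)) [IsFiniteMeasure μ] : Integrable g μ := by
  rw [← integrableOn_univ]
  exact hg.continuousOn.integrableOn_compact isCompact_univ

theorem integral_cantorMeasure {g : (ℕ → Bool) → ℂ} (hg : Continuous g) :
    ∫ x, g x ∂cantorMeasure = 2⁻¹ * (∫ x, g (cantorCons false x) ∂cantorMeasure +
      ∫ x, g (cantorCons true x) ∂cantorMeasure) := by
  have hm : ∀ b, Measurable (cantorCons b) := fun b => (continuous_cantorCons b).measurable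
  have h : ∀ b, ∫ x, g (cantorCons b x) ∂cantorMeasure =
      ∫ x, g x ∂(cantorMeasure.map (cantorCons b)) := fun b =>
    (integral_map (hm b).aemeasurable hg.aestronglyMeasurable).symm
  have hp : ∀ b, IsProbabilityMeasure (cantorMeasure.map (cantorCons b)) := fun b =>
    Measure.isProbabilityMeasure_map (hm b).aemeasurable
  rw [h, h]
  conv_lhs => rw [cantorMeasure_eq]
  rw [integral_smul_measure, integral_add_measure (integrable_of_continuous_cantor hg _)
    (integrable_of_continuous_cantor hg _)]
  simp [mul_add]

theorem cantorMeasure_cylinder (x : ℕ → Bool) (m : ℕ) :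
    cantorMeasure (PiNat.cylinder x m) = (2 : ENNReal)⁻¹ ^ m := by
  have h : PiNat.cylinder x m = ((Finset.range m : Finset ℕ) : Set ℕ).pi fun i => {x i} := by
    rw [PiNat.cylinder_eq_pi]
  rw [h, cantorMeasure, Measure.infinitePi_pi (X := fun _ : ℕ => Bool) (μ := fun _ => fairCoin)
    (t := fun i => {x i}) (fun i _ => measurableSet_singleton _)]
  have : ∀ b, fairCoin {b} = 2⁻¹ := by
    intro b
    cases b <;> simp [fairCoin]
  simp [this]

instance : cantorMeasure.IsOpenPosMeasure := by
  refine ⟨fun U hU ⟨x, hx⟩ h0 => ?_⟩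
  obtain ⟨v, ⟨y, n, rfl⟩, hxv, hvU⟩ :=
    (PiNat.isTopologicalBasis_cylinders (fun _ : ℕ => Bool)).exists_subset_of_mem_open hx hU
  have := measure_mono_null hvU h0
  rw [cantorMeasure_cylinder] at this
  simp at this

/-- The Fourier transform of the distribution of `cantorAngle`. -/
def cantorFourier (t : ℝ) : ℂ := ∫ x, exp ((t * cantorAngle x : ℝ) * I) ∂cantorMeasure

theorem norm_cantorFourier_le_one (t : ℝ) : ‖cantorFourier t‖ ≤ 1 := by
  refine (norm_integral_le_of_norm_le_const (C := 1) (.of_forall fun x => ?_)).trans ?_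
  · rw [norm_exp_ofReal_mul_I]
  · simp

theorem norm_cantorFourier (t : ℝ) :
    ‖cantorFourier t‖ = |Real.cos (2 / 9 * t / 2)| * ‖cantorFourier (2 / 9 * t)‖ := by
  have hc : Continuous fun x => exp ((t * cantorAngle x : ℝ) * I) := by
    have := continuous_cantorAngle
    fun_prop
  have h0 : ∀ b x, cantorAngle (cantorCons b x) = 2 / 9 * ((if b then 1 else 0) + cantorAngle x) :=
    fun b x => cantorAngle_eq _
  have h1 : cantorFourier t =
      2⁻¹ * ((1 + exp ((2 / 9 * t : ℝ) * I)) * cantorFourier (2 / 9 * t)) := by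
    rw [cantorFourier, integral_cantorMeasure hc, cantorFourier, add_mul, one_mul,
      ← integral_const_mul]
    congr 2
    · refine integral_congr_ae (.of_forall fun x => ?_)
      simp only [h0]
      congr 1
      push_cast
      simp
      ring
    · refine integral_congr_ae (.of_forall fun x => ?_)
      beta_reduce
      rw [h0, ← exp_add]
      congr 1
      push_cast
      simp
      ring
  have h2 : (1 : ℂ) + exp ((2 / 9 * t : ℝ) * I) =
      2 * (Real.cos (2 / 9 * t / 2) : ℂ) * exp ((2 / 9 * t / 2 : ℝ) * I) := by
    rw [ofReal_cos, Complex.cos, mul_div_cancel₀ _ (two_ne_zero), add_mul, ← exp_add, ← exp_add]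
    push_cast
    ring_nf
    simp [add_comm]
  rw [h1, h2, norm_mul, norm_mul, norm_mul, norm_mul, norm_exp_ofReal_mul_I, norm_real,
    Real.norm_eq_abs]
  norm_num
  ring

theorem exists_far_from_int {Y : ℝ} (hY : 1 ≤ Y) : ∃ Y' : ℝ, ∀ y ≥ Y', ∃ k : ℕ,
    Y ≤ (2 / 9) ^ k * y ∧ 1 / 12 ≤ |(2 / 9) ^ k * y - round ((2 / 9) ^ k * y)| := by
  obtain ⟨L₀, hL₀⟩ := pow_unbounded_of_one_lt (9 / 2 * Y + 1) (one_lt_two)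
  refine ⟨Y * (9 / 2) ^ L₀, fun y hy => ?_⟩
  have hY0 : 0 < Y := by linarith
  obtain ⟨L, hL1, hL2⟩ := exists_nat_pow_near (x := y / Y) (y := 9 / 2)
    (by
      rw [le_div_iff₀ hY0]
      have : (1 : ℝ) ≤ (9 / 2) ^ L₀ := one_le_pow₀ (by norm_num)
      nlinarith) (by norm_num)
  have hinv : ∀ k : ℕ, (2 / 9 : ℝ) ^ k * (9 / 2) ^ k = 1 := fun k => by
    rw [← mul_pow]; norm_num
  rw [le_div_iff₀ hY0] at hL1
  rw [div_lt_iff₀ hY0] at hL2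
  have hLL : L₀ ≤ L := by
    by_contra! h
    have : (9 / 2 : ℝ) ^ (L + 1) ≤ (9 / 2) ^ L₀ := pow_le_pow_right₀ (by norm_num) h
    nlinarith
  have hyL : ∀ k ≤ L, Y ≤ (2 / 9) ^ k * y := by
    intro k hk
    have h1 : (9 / 2 : ℝ) ^ k ≤ (9 / 2) ^ L := pow_le_pow_right₀ (by norm_num) hk
    have h2 : (0 : ℝ) < (2 / 9) ^ k := by positivity
    calc Y = (2 / 9) ^ k * (9 / 2) ^ k * Y := by rw [hinv, one_mul]
      _ ≤ (2 / 9) ^ k * ((9 / 2) ^ L * Y) := by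
          rw [mul_assoc]; gcongr
      _ ≤ _ := by gcongr
  by_contra! hcon
  have hr : ∀ k ≤ L, |(2 / 9) ^ k * y - round ((2 / 9) ^ k * y)| < 1 / 12 :=
    fun k hk => hcon k (hyL k hk)
  have step : ∀ k < L, 9 * round ((2 / 9 : ℝ) ^ (k + 1) * y) = 2 * round ((2 / 9 : ℝ) ^ k * y) := by
    intro k hk
    have h1 := abs_lt.1 (hr k hk.le)
    have h2 := abs_lt.1 (hr (k + 1) hk)
    rw [pow_succ] at h2 ⊢
    set a := round ((2 / 9 : ℝ) ^ k * y)
    set b := round ((2 / 9 : ℝ) ^ k * (2 / 9) * y)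
    have h3 : ((9 * b - 2 * a : ℤ) : ℝ) < 1 := by push_cast; linarith
    have h4 : (-1 : ℝ) < ((9 * b - 2 * a : ℤ) : ℝ) := by push_cast; linarith
    have h3' : 9 * b - 2 * a < 1 := by exact_mod_cast h3
    have h4' : -1 < 9 * b - 2 * a := by exact_mod_cast h4
    omega
  have all : ∀ k ≤ L, 9 ^ k * round ((2 / 9 : ℝ) ^ k * y) = 2 ^ k * round y := by
    intro k
    induction k with
    | zero => simp
    | succ k ih =>
      intro hk
      have h1 := ih (by omega)
      have h2 := step k (by omega)
      rw [pow_succ, mul_assoc, h2, mul_left_comm, h1, pow_succ]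
      ring
  have hdvd : (9 : ℤ) ^ L ∣ round y := by
    have h1 : (9 : ℤ) ^ L ∣ 2 ^ L * round y := ⟨_, (all L le_rfl).symm⟩
    refine IsCoprime.dvd_of_dvd_mul_left ?_ h1
    exact IsCoprime.pow (by norm_num)
  have h0 := abs_lt.1 (hr 0 (Nat.zero_le _))
  simp only [pow_zero, one_mul] at h0
  have hy1 : 1 ≤ y := by
    have := hyL 0 (Nat.zero_le _)
    simp at this
    linarith
  have hpos : 0 < round y := by
    have : (0 : ℝ) < round y := by linarith
    exact_mod_cast this
  have hle : (9 : ℝ) ^ L ≤ round y := by exact_mod_cast Int.le_of_dvd hpos hdvd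
  have h9 : (9 : ℝ) ^ L ≤ (9 / 2) ^ L * (9 / 2 * Y + 1) := by
    have : (1 : ℝ) ≤ (9 / 2) ^ L := one_le_pow₀ (by norm_num)
    rw [pow_succ] at hL2
    nlinarith
  have h2L : (2 : ℝ) ^ L ≤ 9 / 2 * Y + 1 := by
    have h : (9 : ℝ) ^ L = (9 / 2) ^ L * 2 ^ L := by rw [← mul_pow]; norm_num
    rw [h] at h9
    exact le_of_mul_le_mul_left h9 (by positivity)
  have : (2 : ℝ) ^ L₀ ≤ 2 ^ L := pow_le_pow_right₀ (by norm_num) hLL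
  linarith

theorem abs_cos_pi_mul_le {y : ℝ} (h : 1 / 12 ≤ |y - round y|) :
    |Real.cos (Real.pi * y)| ≤ Real.cos (Real.pi / 12) := by
  have h1 : |Real.cos (Real.pi * y)| = |Real.cos (Real.pi * |y - round y|)| := by
    have : Real.pi * y = Real.pi * (y - round y) + round y * Real.pi := by ring
    rw [this, Real.cos_add_int_mul_pi, abs_mul]
    have h2 : Real.cos (Real.pi * |y - round y|) = Real.cos (Real.pi * (y - round y)) := by
      rw [← Real.cos_abs (Real.pi * (y - round y)), abs_mul, abs_of_pos Real.pi_pos]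
    rw [h2]
    simp [abs_zpow]
  have h3 := abs_sub_round y
  have hp := Real.pi_pos
  rw [h1, abs_of_nonneg]
  · apply Real.cos_le_cos_of_nonneg_of_le_pi <;> nlinarith
  · apply Real.cos_nonneg_of_neg_pi_div_two_le_of_le <;> nlinarith

theorem cantorFourier_tendsto : Tendsto cantorFourier atTop (nhds 0) := by
  set ρ := Real.cos (Real.pi / 12) with hρ
  have hρ1 : ρ < 1 := by
    rw [hρ, ← Real.cos_zero]
    apply Real.cos_lt_cos_of_nonneg_of_le_pi <;> linarith [Real.pi_pos]
  have hρ0 : 0 ≤ ρ := Real.cos_nonneg_of_neg_pi_div_two_le_of_le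
    (by linarith [Real.pi_pos]) (by linarith [Real.pi_pos])
  set J : ℝ → ℝ := fun y => ‖cantorFourier (9 / 2 * (2 * Real.pi * y))‖ with hJ
  have hJrec : ∀ y, J y = |Real.cos (Real.pi * y)| * J (2 / 9 * y) := by
    intro y
    simp only [hJ]
    rw [norm_cantorFourier]
    congr 2
    · congr 1; ring
    · congr 1; ring
  have hJ0 : ∀ y, 0 ≤ J y := fun y => norm_nonneg _
  have hJle : ∀ (k : ℕ) (y : ℝ), J y ≤ J ((2 / 9) ^ k * y) := by
    intro k
    induction k with
    | zero => simp
    | succ k ih =>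
      intro y
      refine (ih y).trans ?_
      rw [hJrec, pow_succ', mul_assoc]
      exact mul_le_of_le_one_left (hJ0 _) (Real.abs_cos_le_one _)
  have hJpow : ∀ j : ℕ, ∃ Y : ℝ, ∀ y ≥ Y, J y ≤ ρ ^ j := by
    intro j
    induction j with
    | zero => exact ⟨0, fun y _ => by simpa using norm_cantorFourier_le_one _⟩
    | succ j ih =>
      obtain ⟨Y, hY⟩ := ih
      obtain ⟨Y', hY'⟩ := exists_far_from_int (Y := max 1 (9 / 2 * Y)) (le_max_left _ _)
      refine ⟨Y', fun y hy => ?_⟩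
      obtain ⟨k, hk1, hk2⟩ := hY' y hy
      refine (hJle k y).trans ?_
      rw [hJrec, pow_succ, mul_comm]
      refine mul_le_mul (hY _ ?_) (abs_cos_pi_mul_le hk2) (abs_nonneg _) (by positivity)
      have := (le_max_right _ _).trans hk1
      show Y ≤ _
      linarith
  rw [NormedAddGroup.tendsto_nhds_zero]
  intro ε hε
  obtain ⟨j, hj⟩ := exists_pow_lt_of_lt_one hε hρ1
  obtain ⟨Y, hY⟩ := hJpow j
  filter_upwards [eventually_ge_atTop (9 / 2 * (2 * Real.pi * Y))] with t ht
  have hp := Real.pi_pos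
  have h1 : t = 9 / 2 * (2 * Real.pi * (t / (9 * Real.pi))) := by
    field_simp
  have h2 : Y ≤ t / (9 * Real.pi) := by
    rw [le_div_iff₀ (by positivity)]
    linarith
  have h3 := hY _ h2
  simp only [hJ] at h3
  rw [← h1] at h3
  exact h3.trans_lt hj

/-- The bundled parametrisation of the perfect symmetric set. -/
def cantorMap : C(ℕ → Bool, ℂ) := ⟨cantorPt, continuous_cantorPt⟩

theorem integral_cantorPt_pow_tendsto :
    Tendsto (fun n : ℕ => ∫ x, cantorPt x ^ n ∂cantorMeasure) atTop (nhds 0) := by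
  have h := cantorFourier_tendsto.comp (tendsto_natCast_atTop_atTop (R := ℝ))
  refine h.congr fun n => ?_
  simp only [Function.comp_def, cantorFourier]
  refine integral_congr_ae (.of_forall fun x => ?_)
  simp only [cantorPt]
  rw [← exp_nat_mul]
  congr 1
  push_cast
  ring

theorem re_cantorPt (x : ℕ → Bool) : 1 / 2 ≤ (cantorPt x).re := by
  rw [cantorPt, exp_ofReal_mul_I_re]
  have h := Real.one_sub_sq_div_two_le_cos (x := cantorAngle x)
  nlinarith [cantorAngle_nonneg x, cantorAngle_le x]

theorem exists_polynomial_near (v : C(ℕ → Bool, ℂ)) {ε : ℝ} (hε : 0 < ε) :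
    ∃ p : Polynomial ℂ, ∀ x, ‖v x - p.eval (cantorPt x)‖ < ε := by
  set A := (Algebra.adjoin ℂ {cantorMap}).topologicalClosure with hA
  have hmem : cantorMap ∈ A :=
    Subalgebra.le_topologicalClosure _ (Algebra.self_mem_adjoin_singleton _ _)
  have hclosed : IsClosed (A : Set C(ℕ → Bool, ℂ)) := Subalgebra.isClosed_topologicalClosure _
  set w : C(ℕ → Bool, ℂ) := 1 - (2⁻¹ : ℂ) • cantorMap with hw
  have hwA : w ∈ A := A.sub_mem A.one_mem (A.smul_mem hmem _)
  have hwn : ‖w‖ < 1 := by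
    rw [ContinuousMap.norm_lt_iff _ one_pos]
    intro x
    have h1 : ‖w x‖ ^ 2 < 1 := by
      rw [← normSq_eq_norm_sq, normSq_apply]
      have h2 : (cantorPt x).re * (cantorPt x).re + (cantorPt x).im * (cantorPt x).im = 1 := by
        rw [← normSq_apply, normSq_eq_norm_sq, norm_cantorPt, one_pow]
      have h3 := re_cantorPt x
      have h4 : w x = 1 - 2⁻¹ * cantorPt x := by simp [hw, cantorMap]
      rw [h4]
      have h5 : (2⁻¹ * cantorPt x).re = 2⁻¹ * (cantorPt x).re := by
        rw [show (2⁻¹ : ℂ) = ((2⁻¹ : ℝ) : ℂ) by norm_num, re_ofReal_mul]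
      have h6 : (2⁻¹ * cantorPt x).im = 2⁻¹ * (cantorPt x).im := by
        rw [show (2⁻¹ : ℂ) = ((2⁻¹ : ℝ) : ℂ) by norm_num, im_ofReal_mul]
      rw [sub_re, sub_im, h5, h6, one_re, one_im]
      nlinarith
    nlinarith [norm_nonneg (w x)]
  have hstar : star cantorMap ∈ A := by
    have h1 : star cantorMap = (2⁻¹ : ℂ) • ∑' n : ℕ, w ^ n := by
      have h2 := geom_series_mul_neg w hwn
      have h3 : (1 : C(ℕ → Bool, ℂ)) - w = (2⁻¹ : ℂ) • cantorMap := by rw [hw]; abel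
      rw [h3] at h2
      have h4 : cantorMap * star cantorMap = 1 := by
        ext x
        simp [cantorMap, mul_conj, normSq_eq_norm_sq, norm_cantorPt]
      calc star cantorMap = 1 * star cantorMap := (one_mul _).symm
        _ = (2⁻¹ : ℂ) • ((∑' n : ℕ, w ^ n) * (cantorMap * star cantorMap)) := by
            rw [← h2]
            simp [mul_assoc, Algebra.smul_mul_assoc]
        _ = _ := by rw [h4, mul_one]
    rw [h1]
    refine A.smul_mem ?_ _
    have hs := (summable_geometric_of_norm_lt_one hwn).hasSum
    exact hclosed.mem_of_tendsto hs.tendsto_sum_nat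
      (.of_forall fun n => A.sum_mem fun i _ => A.pow_mem hwA i)
  have htop : (StarAlgebra.adjoin ℂ {cantorMap}).topologicalClosure = ⊤ := by
    refine ContinuousMap.starSubalgebra_topologicalClosure_eq_top_of_separatesPoints _ ?_
    intro x y hxy
    exact ⟨cantorPt, ⟨cantorMap, StarAlgebra.self_mem_adjoin_singleton ℂ _, rfl⟩,
      fun h => hxy (cantorPt_injective h)⟩
  have hle : (StarAlgebra.adjoin ℂ {cantorMap}).toSubalgebra ≤ A := by
    rw [StarAlgebra.adjoin_toSubalgebra, Algebra.adjoin_le_iff]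
    rintro z (hz | hz)
    · rw [mem_singleton_iff] at hz; rwa [hz]
    · rw [Set.mem_star, mem_singleton_iff] at hz
      rw [← star_star z, hz]; exact hstar
  have hv : v ∈ A := by
    have h1 : v ∈ (StarAlgebra.adjoin ℂ {cantorMap}).topologicalClosure := by
      rw [htop]; trivial
    have h2 : v ∈ closure ((StarAlgebra.adjoin ℂ {cantorMap} : StarSubalgebra ℂ _) :
      Set C(ℕ → Bool, ℂ)) := h1
    exact closure_minimal (fun z hz => hle hz) hclosed h2
  have hv' : v ∈ closure ((Algebra.adjoin ℂ {cantorMap} : Subalgebra ℂ _) :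
    Set C(ℕ → Bool, ℂ)) := hv
  obtain ⟨q, hq, hd⟩ := Metric.mem_closure_iff.1 hv' ε hε
  rw [SetLike.mem_coe, Algebra.adjoin_singleton_eq_range_aeval] at hq
  obtain ⟨p, rfl⟩ := hq
  refine ⟨p, fun x => ?_⟩
  have h1 : ∀ p : Polynomial ℂ, (Polynomial.aeval cantorMap p) x = p.eval (cantorPt x) := by
    intro p
    induction p using Polynomial.induction_on' with
    | add p q hp hq =>
      rw [map_add, ContinuousMap.add_apply, hp, hq, Polynomial.eval_add]
    | monomial n a => simp [cantorMap]
  rw [← h1]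
  rw [dist_eq_norm] at hd
  exact (ContinuousMap.norm_coe_le_norm (v - _) x).trans_lt hd

theorem integral_mul_cantorPt_pow_tendsto (v : C(ℕ → Bool, ℂ)) :
    Tendsto (fun n : ℕ => ∫ x, v x * cantorPt x ^ n ∂cantorMeasure) atTop (nhds 0) := by
  have hpoly : ∀ p : Polynomial ℂ,
      Tendsto (fun n : ℕ => ∫ x, p.eval (cantorPt x) * cantorPt x ^ n ∂cantorMeasure)
        atTop (nhds 0) := by
    have hc := continuous_cantorPt
    intro p
    induction p using Polynomial.induction_on' with
    | add p q hp hq =>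
      have := hp.add hq
      rw [add_zero] at this
      refine this.congr fun n => ?_
      rw [← integral_add (integrable_of_continuous_cantor (by fun_prop) _)
        (integrable_of_continuous_cantor (by fun_prop) _)]
      simp [add_mul]
    | monomial k a =>
      have := ((integral_cantorPt_pow_tendsto.comp (tendsto_add_atTop_nat k)).const_mul a)
      rw [mul_zero] at this
      refine this.congr fun n => ?_
      simp only [Function.comp_def]
      rw [← integral_const_mul]
      refine integral_congr_ae (.of_forall fun x => ?_)
      simp only [Polynomial.eval_monomial]
      ring
  rw [NormedAddGroup.tendsto_nhds_zero]
  intro ε hε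
  obtain ⟨p, hp⟩ := exists_polynomial_near v (half_pos hε)
  filter_upwards [NormedAddGroup.tendsto_nhds_zero.1 (hpoly p) _ (half_pos hε)] with n hn
  have hc := continuous_cantorPt
  have hc2 := v.continuous
  have h1 : ∫ x, v x * cantorPt x ^ n ∂cantorMeasure =
      ∫ x, (v x - p.eval (cantorPt x)) * cantorPt x ^ n ∂cantorMeasure +
      ∫ x, p.eval (cantorPt x) * cantorPt x ^ n ∂cantorMeasure := by
    rw [← integral_add (integrable_of_continuous_cantor (by fun_prop) _)
        (integrable_of_continuous_cantor (by fun_prop) _)]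
    simp [sub_mul]
  have h2 : ‖∫ x, (v x - p.eval (cantorPt x)) * cantorPt x ^ n ∂cantorMeasure‖ ≤ ε / 2 := by
    refine (norm_integral_le_of_norm_le_const (C := ε / 2) (.of_forall fun x => ?_)).trans ?_
    · rw [norm_mul, norm_pow, norm_cantorPt, one_pow, mul_one]
      exact (hp x).le
    · simp
  rw [h1]
  calc _ ≤ _ := norm_add_le _ _
    _ < ε / 2 + ε / 2 := add_lt_add_of_le_of_lt h2 hn
    _ = ε := add_halves ε

theorem exists_APlus_extension {f : ℂ → ℂ} (hf : DifferentiableOn ℂ f (ball 0 1)) {M : ℝ}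
    (hM : ∀ z ∈ ball (0 : ℂ) 1, ‖deriv (deriv f) z‖ ≤ M) :
    ∃ F ∈ APlus, EqOn F f (ball 0 1) := by
  set a : ℕ → ℂ := fun n => (n.factorial : ℂ)⁻¹ * iteratedDeriv n f 0 with ha
  have hM0 : 0 ≤ M := (norm_nonneg _).trans (hM 0 (by simp))
  have hg : DifferentiableOn ℂ (deriv (deriv f)) (ball 0 1) :=
    (hf.deriv isOpen_ball).deriv isOpen_ball
  have hD : ∀ k, ‖iteratedDeriv k (deriv (deriv f)) 0‖ ≤ k.factorial * M := by
    intro k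
    have h1 : ∀ r ∈ Ioo (0 : ℝ) 1,
        ‖iteratedDeriv k (deriv (deriv f)) 0‖ ≤ k.factorial * M / r ^ k := by
      intro r hr
      have hsub : closedBall (0 : ℂ) r ⊆ ball 0 1 := closedBall_subset_ball hr.2
      refine norm_iteratedDeriv_le_of_forall_mem_sphere_norm_le k hr.1 ?_
        fun z hz => hM z (hsub (sphere_subset_closedBall hz))
      exact (hg.mono hsub).diffContOnCl_ball Subset.rfl
    have h2 : Tendsto (fun r : ℝ => k.factorial * M / r ^ k) (nhdsWithin 1 (Iio 1))
        (nhds (k.factorial * M / 1 ^ k)) := by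
      refine Tendsto.mono_left ?_ nhdsWithin_le_nhds
      exact ContinuousAt.tendsto (f := fun r : ℝ => k.factorial * M / r ^ k)
        (by fun_prop (disch := norm_num))
    rw [one_pow, div_one] at h2
    refine ge_of_tendsto h2 ?_
    filter_upwards [Ioo_mem_nhdsLT (zero_lt_one (α := ℝ))] with r hr using h1 r hr
  have hs : Summable fun n => ‖a n‖ := by
    rw [← summable_nat_add_iff 2]
    have h3 : Summable fun n : ℕ => M * (1 / ((n + 1 : ℕ) : ℝ) ^ 2) :=
      ((summable_nat_add_iff 1).2 (Real.summable_one_div_nat_pow.2 one_lt_two)).mul_left M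
    refine .of_nonneg_of_le (fun _ => norm_nonneg _) (fun n => ?_) h3
    have h4 : iteratedDeriv (n + 2) f 0 = iteratedDeriv n (deriv (deriv f)) 0 := by
      rw [iteratedDeriv_succ', iteratedDeriv_succ']
    rw [ha]
    beta_reduce
    rw [h4, norm_mul, norm_inv, norm_natCast]
    have h5 : ((n + 2).factorial : ℝ) = (n + 2) * (n + 1) * n.factorial := by
      rw [Nat.factorial_succ, Nat.factorial_succ]
      push_cast
      ring
    have h6 : (0 : ℝ) < n.factorial := by positivity
    rw [h5, inv_mul_le_iff₀ (by positivity)]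
    refine (hD n).trans ?_
    push_cast
    rw [mul_one_div, mul_div_assoc', le_div_iff₀ (by positivity)]
    nlinarith [mul_nonneg (mul_nonneg h6.le hM0) (by positivity : (0 : ℝ) ≤ (n : ℝ) + 1)]
  have hF : HasTaylor (fun z => ∑' n, a n * z ^ n) a := by
    refine ⟨hs, fun z hz => Summable.hasSum (.of_norm_bounded hs fun n => ?_)⟩
    rw [norm_mul, norm_pow]
    exact mul_le_of_le_one_right (norm_nonneg _)
      (pow_le_one₀ (norm_nonneg _) (by simpa using hz))
  refine ⟨_, hF.mem, fun z hz => ?_⟩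
  refine ((Complex.hasSum_taylorSeries_on_ball hf hz).tsum_eq ▸ ?_)
  refine tsum_congr fun n => ?_
  simp only [ha, sub_zero, smul_eq_mul]
  ring

theorem one_sub_re_pos {x : ℕ → Bool} {z : ℂ} (hz : z ∈ ball (0 : ℂ) 1) :
    0 < (1 - (starRingEnd ℂ) (cantorPt x) * z).re := by
  have h : ‖(starRingEnd ℂ) (cantorPt x) * z‖ < 1 := by
    rw [norm_mul, RCLike.norm_conj, norm_cantorPt, one_mul]
    simpa using hz
  have := (re_le_norm _).trans_lt h
  rw [sub_re, one_re]
  linarith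

theorem norm_one_sub_conj_mul (x : ℕ → Bool) (z : ℂ) :
    ‖1 - (starRingEnd ℂ) (cantorPt x) * z‖ = ‖z - cantorPt x‖ := by
  have h : (starRingEnd ℂ) (cantorPt x) * cantorPt x = 1 := by
    rw [mul_comm, mul_conj, normSq_eq_norm_sq, norm_cantorPt]
    simp
  rw [← h, ← mul_sub, norm_mul, RCLike.norm_conj, norm_cantorPt, one_mul, norm_sub_rev]

/-- Integral of powers of the kernel `1 - conj ζ z` over the perfect symmetric set. -/
def kernelIntegral (A : Set (ℕ → Bool)) (c : (ℕ → Bool) → ℂ) (s : ℝ) (z : ℂ) : ℂ :=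
  ∫ x in A, c x * (1 - (starRingEnd ℂ) (cantorPt x) * z) ^ (s : ℂ) ∂cantorMeasure

theorem continuous_kernel {c : (ℕ → Bool) → ℂ} (hc : Continuous c) (s : ℝ) {z : ℂ}
    (hz : z ∈ ball (0 : ℂ) 1) :
    Continuous fun x => c x * (1 - (starRingEnd ℂ) (cantorPt x) * z) ^ (s : ℂ) := by
  refine hc.mul ?_
  have := continuous_cantorPt
  refine Continuous.cpow (by fun_prop) continuous_const fun x => ?_
  exact Or.inl (one_sub_re_pos hz)

theorem norm_kernelIntegral_le {A : Set (ℕ → Bool)}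
    {c : (ℕ → Bool) → ℂ} (hc : ∀ x, ‖c x‖ ≤ 1) {s d : ℝ} (hs : s ≤ 0) {z : ℂ} (hd : 0 < d)
    (h : ∀ x ∈ A, d ≤ ‖z - cantorPt x‖) : ‖kernelIntegral A c s z‖ ≤ d ^ s := by
  have h0 : 0 ≤ d ^ s := by positivity
  refine (norm_setIntegral_le_of_norm_le_const (C := d ^ s) (measure_lt_top _ _)
    fun x hx => ?_).trans ?_
  · rw [norm_mul, norm_cpow_real, norm_one_sub_conj_mul]
    refine (mul_le_mul (hc x) (Real.rpow_le_rpow_of_nonpos hd (h x hx) hs) (by positivity)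
      zero_le_one).trans_eq (one_mul _)
  · exact mul_le_of_le_one_right h0 measureReal_le_one

theorem hasDerivAt_kernelIntegral (A : Set (ℕ → Bool)) {c : (ℕ → Bool) → ℂ} (hc : Continuous c)
    (hc1 : ∀ x, ‖c x‖ ≤ 1) (s : ℝ) (hs : s ≤ 0) {z : ℂ} (hz : z ∈ ball (0 : ℂ) 1) :
    HasDerivAt (kernelIntegral A c s)
      (-s * kernelIntegral A (fun x => c x * (starRingEnd ℂ) (cantorPt x)) (s - 1) z) z := by
  have hz1 : ‖z‖ < 1 := by simpa using hz
  obtain ⟨r, hr1, hr2⟩ := exists_between hz1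
  have hcont := continuous_cantorPt
  have hc' : Continuous fun x => -s * (c x * (starRingEnd ℂ) (cantorPt x)) := by fun_prop
  have h := hasDerivAt_integral_of_dominated_loc_of_deriv_le (μ := cantorMeasure.restrict A)
    (F := fun z x => c x * (1 - (starRingEnd ℂ) (cantorPt x) * z) ^ (s : ℂ))
    (F' := fun z x => (-s * (c x * (starRingEnd ℂ) (cantorPt x))) *
      (1 - (starRingEnd ℂ) (cantorPt x) * z) ^ ((s - 1 : ℝ) : ℂ))
    (bound := fun _ => |s| * (1 - r) ^ (s - 1)) (s := ball 0 r) (x₀ := z)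
    (isOpen_ball.mem_nhds (by simpa using hr1)) ?_
    (integrable_of_continuous_cantor (continuous_kernel hc s hz) _)
    (continuous_kernel hc' _ hz).aestronglyMeasurable
    (.of_forall fun x w hw => ?_) (integrable_const _) (.of_forall fun x w hw => ?_)
  · convert! h.2 using 1
    rw [kernelIntegral, ← integral_const_mul]
    refine integral_congr_ae (.of_forall fun x => ?_)
    beta_reduce
    ring
  · filter_upwards [isOpen_ball.mem_nhds hz] with w hw
    exact (continuous_kernel hc s hw).aestronglyMeasurable
  · rw [norm_mul, norm_mul, norm_mul, norm_neg, norm_real, Real.norm_eq_abs, RCLike.norm_conj,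
      norm_cantorPt, mul_one, norm_cpow_real, norm_one_sub_conj_mul]
    have hw' : ‖w‖ < r := by simpa using hw
    have h1 : 1 - r ≤ ‖w - cantorPt x‖ := by
      have := norm_sub_norm_le (cantorPt x) w
      rw [norm_cantorPt, norm_sub_rev] at this
      linarith
    refine mul_le_mul (mul_le_of_le_one_right (abs_nonneg _) (hc1 x)) ?_ (by positivity)
      (abs_nonneg _)
    exact Real.rpow_le_rpow_of_nonpos (by linarith) h1 (by linarith)
  · have hw' : w ∈ ball (0 : ℂ) 1 := ball_subset_ball hr2.le hw
    have h1 : HasDerivAt (fun w => 1 - (starRingEnd ℂ) (cantorPt x) * w)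
        (-(starRingEnd ℂ) (cantorPt x)) w := by
      simpa using ((hasDerivAt_id w).const_mul ((starRingEnd ℂ) (cantorPt x))).const_sub 1
    have h2 := (h1.cpow_const (c := (s : ℂ)) (Or.inl (one_sub_re_pos hw'))).const_mul (c x)
    convert! h2 using 1
    push_cast
    ring

theorem re_cpow_neg_half_ge {w : ℂ} (hw : 0 < w.re) :
    1 / 2 * ‖w‖ ^ (-1 / 2 : ℝ) ≤ (w ^ ((-1 / 2 : ℝ) : ℂ)).re := by
  rw [cpow_ofReal_re, mul_comm]
  have h1 : |w.arg| < Real.pi / 2 := abs_arg_lt_pi_div_two_iff.2 (Or.inl hw)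
  have h2 : 1 / 2 ≤ Real.cos (w.arg * (-1 / 2)) := by
    rw [← Real.cos_pi_div_three, ← Real.cos_abs (w.arg * _)]
    have : |w.arg * (-1 / 2)| = |w.arg| / 2 := by
      rw [abs_mul]; norm_num; ring
    rw [this]
    apply Real.cos_le_cos_of_nonneg_of_le_pi <;> linarith [abs_nonneg w.arg, Real.pi_pos]
  gcongr

theorem kernelIntegral_re_ge {A : Set (ℕ → Bool)} {z : ℂ}
    (hz : z ∈ ball (0 : ℂ) 1) {x₀ : ℕ → Bool} {k : ℕ} (hk : PiNat.cylinder x₀ k ⊆ A)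
    {t : ℝ} (h : ∀ x ∈ PiNat.cylinder x₀ k, ‖z - cantorPt x‖ ≤ t) :
    1 / 2 * t ^ (-1 / 2 : ℝ) * (1 / 2) ^ k ≤ (kernelIntegral A 1 (-1 / 2) z).re := by
  have hcont : Continuous fun x => (1 : (ℕ → Bool) → ℂ) x *
      (1 - (starRingEnd ℂ) (cantorPt x) * z) ^ ((-1 / 2 : ℝ) : ℂ) :=
    continuous_kernel continuous_one _ hz
  have h0 : ∀ x, 1 / 2 * ‖z - cantorPt x‖ ^ (-1 / 2 : ℝ) ≤
      ((1 - (starRingEnd ℂ) (cantorPt x) * z) ^ ((-1 / 2 : ℝ) : ℂ)).re := fun x => by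
    rw [← norm_one_sub_conj_mul]
    exact re_cpow_neg_half_ge (one_sub_re_pos hz)
  have hi : ∀ B, IntegrableOn (fun x =>
      ((1 - (starRingEnd ℂ) (cantorPt x) * z) ^ ((-1 / 2 : ℝ) : ℂ)).re) B cantorMeasure := by
    intro B
    have := integrable_of_continuous_cantor hcont (cantorMeasure.restrict B)
    exact this.re.congr (.of_forall fun x => by simp)
  have h1 : (kernelIntegral A 1 (-1 / 2) z).re = ∫ x in A,
      ((1 - (starRingEnd ℂ) (cantorPt x) * z) ^ ((-1 / 2 : ℝ) : ℂ)).re ∂cantorMeasure := by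
    rw [kernelIntegral, ← reCLM_apply, ← reCLM.integral_comp_comm
      (integrable_of_continuous_cantor hcont _)]
    simp
  have hB : MeasurableSet (PiNat.cylinder x₀ k) :=
    (PiNat.isOpen_cylinder (fun _ => Bool) x₀ k).measurableSet
  have hm : cantorMeasure.real (PiNat.cylinder x₀ k) = (1 / 2) ^ k := by
    rw [Measure.real, cantorMeasure_cylinder]
    simp
  rw [h1, ← hm]
  refine (setIntegral_ge_of_const_le_real hB (measure_ne_top _ _) (fun x hx => ?_) (hi _)).trans
    (setIntegral_mono_set (hi A) (.of_forall fun x => ?_) (LE.le.eventuallyLE hk))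
  · refine le_trans ?_ (h0 x)
    have hpos : 0 < ‖z - cantorPt x‖ := by
      rw [← norm_one_sub_conj_mul, norm_pos_iff]
      intro h3
      have := one_sub_re_pos (x := x) hz
      rw [h3] at this
      simp at this
    gcongr ?_ * ?_
    exact Real.rpow_le_rpow_of_nonpos hpos (h x hx) (by norm_num)
  · exact le_trans (by positivity) (h0 x)

theorem cylinder_subset_compl_cylinder {x y : ℕ → Bool} {m n : ℕ} (h : m ≤ n)
    (hy : y ∉ PiNat.cylinder x m) : PiNat.cylinder y n ⊆ (PiNat.cylinder x m)ᶜ := by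
  intro z hz hzx
  apply hy
  intro i hi
  rw [← hz i (by omega), hzx i hi]

theorem half_two_mul_pow_rpow_ge (n : ℕ) :
    1 / 4 * (21 / 20 : ℝ) ^ n ≤
      1 / 2 * (2 * (2 / 9 : ℝ) ^ n) ^ (-1 / 2 : ℝ) * (1 / 2) ^ n := by
  have h1 : (1 / 2 * (21 / 10 : ℝ) ^ n) ≤ (2 * (2 / 9 : ℝ) ^ n) ^ (-1 / 2 : ℝ) := by
    rw [show (-1 / 2 : ℝ) = -(1 / 2) by norm_num, Real.rpow_neg (by positivity),
      ← Real.sqrt_eq_rpow, le_inv_comm₀ (by positivity) (by positivity), Real.sqrt_le_left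
      (by positivity), inv_pow, le_inv_comm₀ (by positivity) (by positivity)]
    have h2 : (441 / 100 : ℝ) ^ n ≤ (9 / 2) ^ n := pow_le_pow_left₀ (by norm_num) (by norm_num) n
    have h3 : (2 * (2 / 9 : ℝ) ^ n)⁻¹ = 1 / 2 * (9 / 2) ^ n := by
      rw [mul_inv, ← inv_pow]; norm_num
    rw [h3, mul_pow, ← pow_mul, mul_comm n 2, pow_mul]
    norm_num
    have h4 : (0 : ℝ) < (9 / 2) ^ n := by positivity
    linarith
  calc 1 / 4 * (21 / 20 : ℝ) ^ n = 1 / 2 * (1 / 2 * (21 / 10 : ℝ) ^ n) * (1 / 2) ^ n := by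
        rw [show (21 / 20 : ℝ) = 21 / 10 * (1 / 2) by norm_num, mul_pow]; ring
    _ ≤ _ := by gcongr

theorem exists_exp_neg_kernelIntegral_le (x : ℕ → Bool) (m : ℕ)
    (hne : (PiNat.cylinder x m)ᶜ.Nonempty) :
    ∃ C : ℝ, 0 ≤ C ∧ ∀ z ∈ ball (0 : ℂ) 1,
      ‖exp (-kernelIntegral (PiNat.cylinder x m)ᶜ 1 (-1 / 2) z)‖ ≤
        C * infDist z (cantorPt '' (PiNat.cylinder x m)ᶜ) ^ 5 := by
  set A := (PiNat.cylinder x m)ᶜ with hA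
  obtain ⟨P, hP⟩ := pow_unbounded_of_one_lt ((9 / 2 : ℝ) ^ 5) (show (1 : ℝ) < 21 / 20 by norm_num)
  have hAc : IsCompact (cantorPt '' A) :=
    (((PiNat.isOpen_cylinder (fun _ => Bool) x m).isClosed_compl).isCompact).image
      continuous_cantorPt
  refine ⟨(9 / 2) ^ (5 * m) + P.factorial * 4 ^ P * (9 / 2) ^ 5, by positivity, fun z hz => ?_⟩
  have hz1 : ‖z‖ < 1 := by simpa using hz
  obtain ⟨_, ⟨x₀, hx₀, rfl⟩, hd⟩ := hAc.exists_infDist_eq_dist (hne.image _) z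
  set d := infDist z (cantorPt '' A) with hd'
  rw [dist_eq_norm] at hd
  have hd0 : 0 < d := by
    rw [hd, ← norm_one_sub_conj_mul, norm_pos_iff]
    intro h3
    have := one_sub_re_pos (x := x₀) hz
    rw [h3] at this
    simp at this
  rw [norm_exp, neg_re]
  have key : ∀ n, m ≤ n → d ≤ (2 / 9) ^ n → 1 / 4 * (21 / 20 : ℝ) ^ n ≤
      (kernelIntegral A 1 (-1 / 2) z).re := by
    intro n hn hdn
    refine (half_two_mul_pow_rpow_ge n).trans (kernelIntegral_re_ge hz
      (cylinder_subset_compl_cylinder hn hx₀) fun y hy => ?_)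
    have h1 := norm_cantorPt_sub_le (PiNat.mem_cylinder_comm _ _ _ |>.1 hy)
    calc ‖z - cantorPt y‖ = ‖(z - cantorPt x₀) + (cantorPt x₀ - cantorPt y)‖ := by
          congr 1; ring
      _ ≤ _ := norm_add_le _ _
      _ ≤ 2 * (2 / 9) ^ n := by rw [← hd]; linarith
  rcases lt_or_ge ((2 / 9 : ℝ) ^ m) d with h | h
  · have h1 : (0 : ℝ) ≤ (kernelIntegral A 1 (-1 / 2) z).re := by
      have := kernelIntegral_re_ge hz (cylinder_subset_compl_cylinder le_rfl hx₀) (t := 2)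
        fun y hy => ?_
      · exact le_trans (by positivity) this
      · refine (norm_sub_le _ _).trans ?_
        rw [norm_cantorPt]
        linarith
    calc Real.exp (-(kernelIntegral A 1 (-1 / 2) z).re) ≤ 1 := by
          rw [Real.exp_le_one_iff]; linarith
      _ = (9 / 2) ^ (5 * m) * ((2 / 9 : ℝ) ^ m) ^ 5 := by
          rw [← pow_mul, mul_comm m 5, ← mul_pow]; norm_num
      _ ≤ (9 / 2) ^ (5 * m) * d ^ 5 := by gcongr
      _ ≤ _ := by
        gcongr
        exact le_add_of_nonneg_right (by positivity)
  · obtain ⟨n, hn1, hn2⟩ := exists_nat_pow_near_of_lt_one hd0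
      (h.trans (pow_le_one₀ (by norm_num) (by norm_num))) (show (0 : ℝ) < 2 / 9 by norm_num)
      (by norm_num)
    have hmn : m ≤ n := by
      by_contra! hlt
      have : (2 / 9 : ℝ) ^ m ≤ (2 / 9) ^ (n + 1) :=
        pow_le_pow_of_le_one (by norm_num) (by norm_num) hlt
      linarith
    have h1 := key n hmn hn2
    have h2 : (0 : ℝ) < 1 / 4 * (21 / 20 : ℝ) ^ n := by positivity
    have h3 := Real.pow_div_factorial_le_exp _ h2.le P
    have h4 : Real.exp (-(kernelIntegral A 1 (-1 / 2) z).re) ≤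
        P.factorial / (1 / 4 * (21 / 20 : ℝ) ^ n) ^ P := by
      calc _ ≤ Real.exp (-(1 / 4 * (21 / 20 : ℝ) ^ n)) := by gcongr
        _ ≤ _ := by
          rw [Real.exp_neg, inv_le_comm₀ (by positivity) (by positivity), inv_div]
          exact h3
    have h5 : P.factorial / (1 / 4 * (21 / 20 : ℝ) ^ n) ^ P ≤
        P.factorial * 4 ^ P * (9 / 2) ^ 5 * ((2 / 9 : ℝ) ^ (n + 1)) ^ 5 := by
      have h6 : ((9 / 2 : ℝ) ^ 5) ^ n ≤ ((21 / 20 : ℝ) ^ n) ^ P := by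
        rw [← pow_mul (21 / 20 : ℝ) n P, mul_comm n P, pow_mul (21 / 20 : ℝ)]
        exact pow_le_pow_left₀ (by positivity) hP.le n
      have h7 : ((2 / 9 : ℝ) ^ (n + 1)) ^ 5 = ((9 / 2 : ℝ) ^ 5)⁻¹ * (((9 / 2 : ℝ) ^ 5) ^ n)⁻¹ := by
        rw [← pow_mul, ← pow_mul, ← inv_pow, ← inv_pow, ← pow_add]
        norm_num
        ring
      rw [h7, mul_pow, div_eq_mul_inv, mul_inv]
      calc _ ≤ (P.factorial : ℝ) * (((1 / 4 : ℝ) ^ P)⁻¹ * (((9 / 2 : ℝ) ^ 5) ^ n)⁻¹) := by gcongr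
        _ = _ := by
          rw [← inv_pow]
          norm_num
          ring
    refine h4.trans (h5.trans ?_)
    calc _ ≤ P.factorial * 4 ^ P * (9 / 2) ^ 5 * d ^ 5 := by gcongr
      _ ≤ _ := by
        gcongr
        exact le_add_of_nonneg_left (by positivity)

theorem norm_deriv_deriv_exp_neg_kernelIntegral_le {A : Set (ℕ → Bool)} (hne : A.Nonempty)
    (hA : IsClosed A) {C : ℝ} (hC0 : 0 ≤ C)
    (hC : ∀ z ∈ ball (0 : ℂ) 1, ‖exp (-kernelIntegral A 1 (-1 / 2) z)‖ ≤
      C * infDist z (cantorPt '' A) ^ 5) {z : ℂ} (hz : z ∈ ball (0 : ℂ) 1) :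
    ‖deriv (deriv fun z => exp (-kernelIntegral A 1 (-1 / 2) z)) z‖ ≤
      C * (4 + 2 ^ (5 / 2 : ℝ)) := by
  have hcont := continuous_cantorPt
  set c₁ : (ℕ → Bool) → ℂ := fun x => (1 : (ℕ → Bool) → ℂ) x * (starRingEnd ℂ) (cantorPt x)
    with hc₁
  set c₂ : (ℕ → Bool) → ℂ := fun x => c₁ x * (starRingEnd ℂ) (cantorPt x) with hc₂
  have hc₁c : Continuous c₁ := by simp only [hc₁, Pi.one_apply]; fun_prop
  have hn₁ : ∀ x, ‖c₁ x‖ ≤ 1 := fun x => by simp [hc₁, norm_cantorPt]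
  have hn₂ : ∀ x, ‖c₂ x‖ ≤ 1 := fun x => by simp [hc₂, hc₁, norm_cantorPt]
  have hH : ∀ w ∈ ball (0 : ℂ) 1, HasDerivAt (kernelIntegral A 1 (-1 / 2))
      (-((-1 / 2 : ℝ) : ℂ) * kernelIntegral A c₁ (-1 / 2 - 1) w) w := fun w hw =>
    hasDerivAt_kernelIntegral A continuous_one (by simp) _ (by norm_num) hw
  have hH₁ : ∀ w ∈ ball (0 : ℂ) 1, HasDerivAt (kernelIntegral A c₁ (-1 / 2 - 1))
      (-((-1 / 2 - 1 : ℝ) : ℂ) * kernelIntegral A c₂ (-1 / 2 - 1 - 1) w) w := fun w hw =>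
    hasDerivAt_kernelIntegral A hc₁c hn₁ _ (by norm_num) hw
  have he : deriv (fun z => exp (-kernelIntegral A 1 (-1 / 2) z)) =ᶠ[nhds z]
      fun w => exp (-kernelIntegral A 1 (-1 / 2) w) *
        -(-((-1 / 2 : ℝ) : ℂ) * kernelIntegral A c₁ (-1 / 2 - 1) w) := by
    filter_upwards [isOpen_ball.mem_nhds hz] with w hw
    exact (hH w hw).neg.cexp.deriv
  have hD : HasDerivAt (fun w => exp (-kernelIntegral A 1 (-1 / 2) w) *
        -(-((-1 / 2 : ℝ) : ℂ) * kernelIntegral A c₁ (-1 / 2 - 1) w)) _ z :=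
    (hH z hz).neg.cexp.mul ((hH₁ z hz).const_mul _).neg
  rw [he.deriv_eq, hD.deriv]
  simp only [Pi.neg_apply]
  have hcpt : IsCompact (cantorPt '' A) := hA.isCompact.image hcont
  set d := infDist z (cantorPt '' A) with hd'
  have hdle : ∀ x ∈ A, d ≤ ‖z - cantorPt x‖ := fun x hx => by
    rw [← dist_eq_norm]
    exact infDist_le_dist_of_mem (mem_image_of_mem _ hx)
  obtain ⟨_, ⟨x₀, hx₀, rfl⟩, hd⟩ := hcpt.exists_infDist_eq_dist (hne.image _) z
  rw [dist_eq_norm] at hd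
  have hd0 : 0 < d := by
    rw [hd', hd, ← norm_one_sub_conj_mul, norm_pos_iff]
    intro h3
    have := one_sub_re_pos (x := x₀) hz
    rw [h3] at this
    simp at this
  have hd2 : d ≤ 2 := by
    rw [hd', hd]
    refine (norm_sub_le _ _).trans ?_
    rw [norm_cantorPt]
    have : ‖z‖ < 1 := by simpa using hz
    linarith
  have hK₁ := norm_kernelIntegral_le (A := A) hn₁ (s := -1 / 2 - 1) (by norm_num) hd0 hdle
  have hK₂ := norm_kernelIntegral_le (A := A) hn₂ (s := -1 / 2 - 1 - 1) (by norm_num) hd0 hdle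
  have hE := hC z hz
  have e1 : d ^ 5 * (d ^ (-1 / 2 - 1 : ℝ)) ^ 2 = d ^ 2 := by
    rw [← Real.rpow_natCast, ← Real.rpow_natCast, ← Real.rpow_natCast, ← Real.rpow_mul hd0.le,
      ← Real.rpow_add hd0]
    norm_num
  have e2 : d ^ 5 * d ^ (-1 / 2 - 1 - 1 : ℝ) = d ^ (5 / 2 : ℝ) := by
    rw [← Real.rpow_natCast, ← Real.rpow_add hd0]
    norm_num
  have e3 : d ^ (5 / 2 : ℝ) ≤ 2 ^ (5 / 2 : ℝ) := by gcongr
  have e4 : d ^ 2 ≤ 4 := by nlinarith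
  generalize exp (-kernelIntegral A 1 (-1 / 2) z) = E at hE ⊢
  generalize kernelIntegral A c₁ (-1 / 2 - 1) z = K₁ at hK₁ ⊢
  generalize kernelIntegral A c₂ (-1 / 2 - 1 - 1) z = K₂ at hK₂ ⊢
  have e5 : E * -(-((-1 / 2 : ℝ) : ℂ) * K₁) * -(-((-1 / 2 : ℝ) : ℂ) * K₁) +
      E * -(-((-1 / 2 : ℝ) : ℂ) * (-((-1 / 2 - 1 : ℝ) : ℂ) * K₂)) =
      E * (1 / 4 * K₁ ^ 2 - (3 / 4) * K₂) := by
    push_cast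
    ring
  rw [e5, norm_mul]
  have e6 : ‖1 / 4 * K₁ ^ 2 - (3 / 4) * K₂‖ ≤
      (d ^ (-1 / 2 - 1 : ℝ)) ^ 2 + d ^ (-1 / 2 - 1 - 1 : ℝ) := by
    refine (norm_sub_le _ _).trans ?_
    rw [norm_mul, norm_mul, norm_pow]
    have a1 : ‖(1 / 4 : ℂ)‖ ≤ 1 := by norm_num
    have a2 : ‖(3 / 4 : ℂ)‖ ≤ 1 := by norm_num
    exact add_le_add ((mul_le_of_le_one_left (by positivity) a1).trans (by gcongr))
      ((mul_le_of_le_one_left (by positivity) a2).trans hK₂)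
  calc ‖E‖ * ‖1 / 4 * K₁ ^ 2 - (3 / 4) * K₂‖
      ≤ C * d ^ 5 * ((d ^ (-1 / 2 - 1 : ℝ)) ^ 2 + d ^ (-1 / 2 - 1 - 1 : ℝ)) := by gcongr
    _ = C * (d ^ 2 + d ^ (5 / 2 : ℝ)) := by rw [← e1, ← e2]; ring
    _ ≤ _ := by gcongr

theorem exists_localizer (x : ℕ → Bool) (m : ℕ) : ∃ e ∈ APlus,
    (∀ y ∉ PiNat.cylinder x m, e (cantorPt y) = 0) ∧
      ∀ y ∈ PiNat.cylinder x m, e (cantorPt y) ≠ 0 := by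
  rcases (PiNat.cylinder x m)ᶜ.eq_empty_or_nonempty with hemp | hne
  · refine ⟨fun _ => 1, const_mem_APlus 1, fun y hy => ?_, fun y _ => one_ne_zero⟩
    have : y ∈ (PiNat.cylinder x m)ᶜ := hy
    simp [hemp] at this
  obtain ⟨C, hC0, hC⟩ := exists_exp_neg_kernelIntegral_le x m hne
  have hA : IsClosed (PiNat.cylinder x m)ᶜ :=
    (PiNat.isOpen_cylinder (fun _ => Bool) x m).isClosed_compl
  obtain ⟨F, hF, hFe⟩ := exists_APlus_extension
    (f := fun z => exp (-kernelIntegral (PiNat.cylinder x m)ᶜ 1 (-1 / 2) z))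
    (fun z hz => (hasDerivAt_kernelIntegral _ continuous_one (by simp) _ (by norm_num)
      hz).neg.cexp.differentiableAt.differentiableWithinAt)
    (fun z hz => norm_deriv_deriv_exp_neg_kernelIntegral_le hne hA hC0 hC hz)
  have hr0 : Tendsto (fun n : ℕ => 1 / ((n : ℝ) + 1)) atTop (nhds 0) :=
    tendsto_one_div_add_atTop_nhds_zero_nat
  have hr1 : ∀ n : ℕ, 1 / ((n : ℝ) + 1) ≤ 1 := fun n => by
    rw [div_le_one (by positivity)]; linarith [n.cast_nonneg (α := ℝ)]
  have hrp : ∀ n : ℕ, 0 < 1 / ((n : ℝ) + 1) := fun n => by positivity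
  generalize hr : (fun n : ℕ => 1 / ((n : ℝ) + 1)) = r at hr0
  have hr1 : ∀ n, r n ≤ 1 := by rw [← hr]; exact hr1
  have hrp : ∀ n, 0 < r n := by rw [← hr]; exact hrp
  have hball : ∀ n y, ((1 - r n : ℝ) : ℂ) * cantorPt y ∈ ball (0 : ℂ) 1 := fun n y => by
    rw [mem_ball_zero_iff, norm_mul, norm_cantorPt, mul_one, norm_real, Real.norm_eq_abs,
      abs_of_nonneg (by linarith [hr1 n])]
    linarith [hrp n]
  have hlim : ∀ y, Tendsto (fun n => F (((1 - r n : ℝ) : ℂ) * cantorPt y)) atTop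
      (nhds (F (cantorPt y))) := fun y => by
    have h1 : cantorPt y ∈ closedBall (0 : ℂ) 1 := by simp [norm_cantorPt]
    refine (continuousOn_of_mem_APlus hF _ h1).tendsto.comp
      (tendsto_nhdsWithin_iff.2 ⟨?_, .of_forall fun n => ball_subset_closedBall (hball n y)⟩)
    have h2 : Tendsto (fun n => ((1 - r n : ℝ) : ℂ) * cantorPt y) atTop
        (nhds (((1 - 0 : ℝ) : ℂ) * cantorPt y)) :=
      ((continuous_ofReal.tendsto _).comp (hr0.const_sub 1)).mul_const _
    simpa using h2
  have hdist : ∀ n y, ‖((1 - r n : ℝ) : ℂ) * cantorPt y - cantorPt y‖ = r n := fun n y => by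
    rw [show ((1 - r n : ℝ) : ℂ) * cantorPt y - cantorPt y = -(r n : ℂ) * cantorPt y by
      push_cast; ring, norm_mul, norm_cantorPt, norm_neg, norm_real, mul_one, Real.norm_eq_abs,
      abs_of_pos (hrp n)]
  refine ⟨F, hF, fun y hy => ?_, fun y hy => ?_⟩
  · have h1 : Tendsto (fun n => F (((1 - r n : ℝ) : ℂ) * cantorPt y)) atTop (nhds 0) := by
      refine squeeze_zero_norm (a := fun n => C * r n ^ 5) (fun n => ?_) ?_
      · rw [hFe (hball n y)]
        refine (hC _ (hball n y)).trans ?_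
        have h2 : infDist (((1 - r n : ℝ) : ℂ) * cantorPt y)
            (cantorPt '' (PiNat.cylinder x m)ᶜ) ≤ r n := by
          refine (infDist_le_dist_of_mem (mem_image_of_mem cantorPt (mem_compl hy))).trans_eq ?_
          rw [dist_eq_norm, hdist]
        have h3 := infDist_nonneg (x := ((1 - r n : ℝ) : ℂ) * cantorPt y)
          (s := cantorPt '' (PiNat.cylinder x m)ᶜ)
        gcongr
      · simpa using (hr0.pow 5).const_mul C
    exact tendsto_nhds_unique (hlim y) h1
  · have hcl : IsClosed (cantorPt '' (PiNat.cylinder x m)ᶜ) :=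
      (hA.isCompact.image continuous_cantorPt).isClosed
    have hδ : 0 < infDist (cantorPt y) (cantorPt '' (PiNat.cylinder x m)ᶜ) := by
      rw [← hcl.notMem_iff_infDist_pos (hne.image _)]
      rintro ⟨y', hy', h⟩
      exact hy' (cantorPt_injective h ▸ hy)
    set δ := infDist (cantorPt y) (cantorPt '' (PiNat.cylinder x m)ᶜ) with hδ'
    have h1 : Real.exp (-(δ / 2) ^ (-1 / 2 : ℝ)) ≤ ‖F (cantorPt y)‖ := by
      refine ge_of_tendsto (hlim y).norm ?_
      filter_upwards [hr0.eventually (gt_mem_nhds (half_pos hδ))] with n hn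
      rw [hFe (hball n y)]
      simp only [norm_exp, neg_re]
      gcongr
      refine (re_le_norm _).trans (norm_kernelIntegral_le (by simp) (by norm_num)
        (half_pos hδ) fun x' hx' => ?_)
      have h2 : δ ≤ ‖cantorPt y - cantorPt x'‖ := by
        rw [← dist_eq_norm]
        exact infDist_le_dist_of_mem (mem_image_of_mem _ hx')
      have h3 := norm_sub_norm_le (cantorPt y - cantorPt x')
        (cantorPt y - ((1 - r n : ℝ) : ℂ) * cantorPt y)
      rw [norm_sub_rev (cantorPt y) (_ * _), hdist] at h3
      rw [show ((1 - r n : ℝ) : ℂ) * cantorPt y - cantorPt x' = cantorPt y - cantorPt x' -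
        (cantorPt y - ((1 - r n : ℝ) : ℂ) * cantorPt y) by ring]
      linarith
    exact norm_pos_iff.1 ((Real.exp_pos _).trans_le h1)

theorem exists_polynomial_re_neg {δ : ℝ} (hδ : 0 < δ) : ∃ p : Polynomial ℂ, p.eval 0 = 0 ∧
    ∀ w : ℂ, ‖w‖ = 1 → δ ≤ ‖w - 1‖ → (p.eval w).re ≤ -1 / 4 := by
  obtain ⟨ρ, hρ1, hρ2⟩ : ∃ ρ : ℝ, max 0 (max (1 - δ / 2) (1 - δ ^ 2 / 16)) < ρ ∧ ρ < 1 := by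
    apply exists_between
    have : 0 < δ ^ 2 := by positivity
    simp only [max_lt_iff]
    refine ⟨one_pos, ?_, ?_⟩ <;> linarith
  simp only [max_lt_iff] at hρ1
  obtain ⟨h0, h1, h2⟩ := hρ1
  obtain ⟨n, hn⟩ := exists_pow_lt_of_lt_one (show 0 < (1 - ρ) / 8 by linarith) hρ2
  refine ⟨∑ k ∈ Finset.range n, Polynomial.C (2 * (ρ : ℂ) ^ (k + 1)) * Polynomial.X ^ (k + 1),
    ?_, fun w hw hwδ => ?_⟩
  · simp [Polynomial.eval_finsetSum]
  set v : ℂ := ρ * w with hv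
  have hvn : ‖v‖ = ρ := by simp [hv, hw, abs_of_pos h0]
  have hv1 : v ≠ 1 := fun h => by rw [h, norm_one] at hvn; linarith
  have hd1 : 1 - ρ ≤ ‖1 - v‖ := by
    have := norm_sub_norm_le 1 v
    rwa [norm_one, hvn] at this
  have hd2 : δ / 2 ≤ ‖1 - v‖ := by
    have h3 := norm_sub_le (w - 1) (w - v)
    rw [show w - 1 - (w - v) = -(1 - v) by ring, norm_neg] at h3
    have h4 := norm_sub_norm_le (w - 1) (w - v)
    rw [show w - 1 - (w - v) = -(1 - v) by ring, norm_neg] at h4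
    have h5 : ‖w - v‖ = 1 - ρ := by
      rw [hv, show w - ρ * w = ((1 - ρ : ℝ) : ℂ) * w by push_cast; ring, norm_mul, hw, norm_real,
        Real.norm_eq_abs, abs_of_pos (by linarith), mul_one]
    linarith
  have hd0 : 0 < ‖1 - v‖ := by linarith
  have hne : 1 - v ≠ 0 := norm_pos_iff.1 hd0
  have heval : Polynomial.eval w (∑ k ∈ Finset.range n,
      Polynomial.C (2 * (ρ : ℂ) ^ (k + 1)) * Polynomial.X ^ (k + 1)) =
      (1 + v) / (1 - v) - 1 - 2 * v * v ^ n / (1 - v) := by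
    rw [Polynomial.eval_finsetSum]
    have : ∀ k ∈ Finset.range n, Polynomial.eval w (Polynomial.C (2 * (ρ : ℂ) ^ (k + 1)) *
        Polynomial.X ^ (k + 1)) = 2 * v * v ^ k := fun k _ => by
      simp [hv, mul_pow, pow_succ]; ring
    rw [Finset.sum_congr rfl this, ← Finset.mul_sum, geom_sum_eq hv1]
    have h' : v - 1 ≠ 0 := sub_ne_zero.2 hv1
    field_simp
    ring
  have hre : ((1 + v) / (1 - v)).re = (1 - ρ ^ 2) / ‖1 - v‖ ^ 2 := by
    rw [div_re, ← normSq_eq_norm_sq, ← add_div, ← hvn, ← normSq_eq_norm_sq]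
    congr 1
    simp [normSq_apply]
    ring
  have htail : -(2 * v * v ^ n / (1 - v)).re ≤ 1 / 4 := by
    refine (neg_le_abs _).trans ((abs_re_le_norm _).trans ?_)
    rw [norm_div, norm_mul, norm_mul, norm_pow, hvn, div_le_iff₀ hd0]
    have : ρ * ρ ^ n ≤ ρ ^ n := mul_le_of_le_one_left (by positivity) hρ2.le
    rw [Complex.norm_ofNat]
    linarith
  have hmain : (1 - ρ ^ 2) / ‖1 - v‖ ^ 2 ≤ 1 / 2 := by
    rw [div_le_iff₀ (by positivity)]
    have : (δ / 2) ^ 2 ≤ ‖1 - v‖ ^ 2 := by gcongr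
    nlinarith
  rw [heval, sub_re, sub_re, hre, one_re]
  linarith

theorem exists_polynomial_small_off_arc {δ τ : ℝ} (hδ : 0 < δ) (hτ : 0 < τ) :
    ∃ q : Polynomial ℂ, q.coeff 0 = 1 ∧
      ∀ w : ℂ, ‖w‖ = 1 → δ ≤ ‖w - 1‖ → ‖q.eval w‖ ≤ τ := by
  obtain ⟨p, hp0, hp⟩ := exists_polynomial_re_neg hδ
  obtain ⟨R, hR⟩ := (isCompact_sphere (0 : ℂ) 1).exists_bound_of_continuousOn
    p.continuous.continuousOn
  set R' := max R 1 with hR'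
  have hR1 : 1 ≤ R' := le_max_right _ _
  set s : ℝ := 1 / (4 * R' ^ 2) with hs
  have hs0 : 0 < s := by positivity
  have hs1 : s * R' ^ 2 = 1 / 4 := by rw [hs]; field_simp
  obtain ⟨J, hJ⟩ := exists_pow_lt_of_lt_one (pow_pos hτ 2)
    (show 1 - s / 4 < 1 by linarith)
  refine ⟨(1 + Polynomial.C (s : ℂ) * p) ^ J, ?_, fun w hw hwδ => ?_⟩
  · rw [Polynomial.coeff_zero_eq_eval_zero]
    simp [hp0]
  have h1 : ‖p.eval w‖ ≤ R' := (hR w (by simpa using hw)).trans (le_max_left _ _)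
  have h2 := hp w hw hwδ
  have h3 : ‖1 + (s : ℂ) * p.eval w‖ ^ 2 ≤ 1 - s / 4 := by
    rw [← normSq_eq_norm_sq, normSq_add, normSq_mul, normSq_ofReal, normSq_eq_norm_sq (p.eval w)]
    simp only [map_one, one_mul, map_mul, conj_ofReal, re_ofReal_mul, conj_re]
    have h4 : ‖p.eval w‖ ^ 2 ≤ R' ^ 2 := by gcongr
    have h5 : s * s * ‖p.eval w‖ ^ 2 ≤ s * (1 / 4) := by
      rw [← hs1, ← mul_assoc]; gcongr
    nlinarith
  refine (sq_le_sq₀ (norm_nonneg _) hτ.le).1 ?_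
  simp only [Polynomial.eval_pow, Polynomial.eval_add, Polynomial.eval_one, Polynomial.eval_mul,
    Polynomial.eval_C, norm_pow]
  rw [← pow_mul, mul_comm J 2, pow_mul]
  exact (pow_le_pow_left₀ (by positivity) h3 J).trans hJ.le

/-- A cut-off equal to one near `1` and vanishing at distance `δ` from `1`. -/
def arcCutoff (δ : ℝ) (w : ℂ) : ℝ := max 0 (min 1 (2 - 2 * ‖w - 1‖ / δ))

theorem continuous_arcCutoff (δ : ℝ) : Continuous (arcCutoff δ) := by
  unfold arcCutoff
  fun_prop

theorem arcCutoff_eq_zero {δ : ℝ} (hδ : 0 < δ) {w : ℂ} (h : δ ≤ ‖w - 1‖) :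
    arcCutoff δ w = 0 := by
  rw [arcCutoff, max_eq_left]
  refine (min_le_right _ _).trans ?_
  have : 2 ≤ 2 * ‖w - 1‖ / δ := by rw [le_div_iff₀ hδ]; linarith
  linarith

theorem arcCutoff_eq_one {δ : ℝ} (hδ : 0 < δ) {w : ℂ} (h : ‖w - 1‖ ≤ δ / 2) :
    arcCutoff δ w = 1 := by
  have : 2 * ‖w - 1‖ / δ ≤ 1 := by rw [div_le_iff₀ hδ]; linarith
  rw [arcCutoff, min_eq_left (by linarith), max_eq_right zero_le_one]

theorem abs_arcCutoff_sub_one_le (δ : ℝ) (w : ℂ) : |arcCutoff δ w - 1| ≤ 1 := by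
  have h0 : 0 ≤ arcCutoff δ w := le_max_left _ _
  have h1 : arcCutoff δ w ≤ 1 := max_le zero_le_one (min_le_left _ _)
  rw [abs_le]
  constructor <;> linarith

theorem norm_circle_conj_mul_sub_one (c : Circle) (z : ℂ) :
    ‖z * (starRingEnd ℂ) (c : ℂ) - 1‖ = ‖z - c‖ := by
  have h : (c : ℂ) * (starRingEnd ℂ) (c : ℂ) = 1 := by
    rw [mul_conj, normSq_eq_norm_sq, Circle.norm_coe]
    simp
  rw [← h, ← sub_mul, norm_mul, RCLike.norm_conj, Circle.norm_coe, mul_one]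

theorem exists_thin_step (u : C(ℕ → Bool, ℂ)) (h : C(ℕ → Bool, Circle)) {ε δ : ℝ} (hε : 0 < ε)
    (hδ : 0 < δ) (N₀ : ℕ) : ∃ N ≥ N₀, ∃ u' : C(ℕ → Bool, ℂ),
      (∀ x, u' x ≠ 0 → u x ≠ 0 ∧ ‖cantorPt x ^ N - h x‖ ≤ δ) ∧
      ∀ n : ℕ, ‖∫ x, (u' x - u x) * cantorPt x ^ n ∂cantorMeasure‖ ≤ ε := by
  have hcont := continuous_cantorPt
  have hhc : Continuous fun x => (h x : ℂ) := by fun_prop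
  set τ := ε / (2 * (‖u‖ + 1)) with hτd
  have hτ : 0 < τ := by positivity
  obtain ⟨q, hq0, hq⟩ := exists_polynomial_small_off_arc (half_pos hδ) hτ
  set D := q.natDegree
  set B := ∑ k ∈ Finset.range D, ‖q.coeff (k + 1)‖ with hB
  have hB0 : 0 ≤ B := Finset.sum_nonneg fun _ _ => norm_nonneg _
  let v : ℕ → C(ℕ → Bool, ℂ) := fun k =>
    ⟨fun x => u x * (starRingEnd ℂ) (h x : ℂ) ^ (k + 1), by fun_prop⟩
  have hRL : ∀ᶠ j : ℕ in atTop, ∀ k ∈ Finset.range D,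
      ‖∫ x, v k x * cantorPt x ^ j ∂cantorMeasure‖ < ε / (2 * (B + 1)) := by
    rw [eventually_all_finset]
    intro k _
    have := (integral_mul_cantorPt_pow_tendsto (v k)).norm
    rw [norm_zero] at this
    exact this.eventually (gt_mem_nhds (by positivity))
  obtain ⟨N₁, hN₁⟩ := eventually_atTop.1 hRL
  set N := max N₀ N₁ with hN
  let w : (ℕ → Bool) → ℂ := fun x => cantorPt x ^ N * (starRingEnd ℂ) (h x : ℂ)
  have hw : Continuous w := by fun_prop
  have hwn : ∀ x, ‖w x‖ = 1 := fun x => by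
    simp [w, norm_cantorPt, Circle.norm_coe]
  have hw1 : ∀ x, ‖w x - 1‖ = ‖cantorPt x ^ N - h x‖ := fun x => norm_circle_conj_mul_sub_one _ _
  have hqc := q.continuous
  have hχc := continuous_arcCutoff δ
  refine ⟨N, le_max_left _ _, ⟨fun x => u x * (q.eval (w x) * arcCutoff δ (w x)), by fun_prop⟩,
    fun x hx => ⟨?_, ?_⟩, fun n => ?_⟩
  · simp only [ContinuousMap.coe_mk, ne_eq, mul_eq_zero, not_or] at hx
    exact hx.1
  · rw [← hw1]
    by_contra! hlt
    exact hx (by simp [arcCutoff_eq_zero hδ hlt.le])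
  · have hsplit : ∀ x, (u x * (q.eval (w x) * arcCutoff δ (w x)) - u x) * cantorPt x ^ n =
        u x * (q.eval (w x) * (arcCutoff δ (w x) - 1 : ℝ)) * cantorPt x ^ n +
        ∑ k ∈ Finset.range D, q.coeff (k + 1) * (v k x * cantorPt x ^ (N * (k + 1) + n)) := by
      intro x
      have he : q.eval (w x) = 1 + ∑ k ∈ Finset.range D, q.coeff (k + 1) * w x ^ (k + 1) := by
        rw [Polynomial.eval_eq_sum_range, Finset.sum_range_succ', hq0]
        simp [add_comm, D]
      have hs : ∑ k ∈ Finset.range D, q.coeff (k + 1) *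
          (v k x * cantorPt x ^ (N * (k + 1) + n)) =
          u x * (q.eval (w x) - 1) * cantorPt x ^ n := by
        rw [he, add_sub_cancel_left, Finset.mul_sum, Finset.sum_mul]
        refine Finset.sum_congr rfl fun k _ => ?_
        simp only [v, w, ContinuousMap.coe_mk, mul_pow, pow_add, pow_mul]
        ring
      rw [hs]
      push_cast
      ring
    simp only [ContinuousMap.coe_mk]
    simp_rw [hsplit]
    have hint₁ : Integrable (fun x => u x * (q.eval (w x) * (arcCutoff δ (w x) - 1 : ℝ)) *
        cantorPt x ^ n) cantorMeasure := integrable_of_continuous_cantor (by fun_prop) _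
    have hint₂ : ∀ k ∈ Finset.range D, Integrable (fun x => q.coeff (k + 1) *
        (v k x * cantorPt x ^ (N * (k + 1) + n))) cantorMeasure := fun k _ =>
      integrable_of_continuous_cantor (by fun_prop) _
    rw [integral_add hint₁ (integrable_finsetSum _ hint₂), integral_finsetSum _ hint₂]
    refine (norm_add_le _ _).trans ?_
    have hb₁ : ‖∫ x, u x * (q.eval (w x) * (arcCutoff δ (w x) - 1 : ℝ)) *
        cantorPt x ^ n ∂cantorMeasure‖ ≤ ‖u‖ * τ := by
      have := norm_integral_le_of_norm_le_const (μ := cantorMeasure) (C := ‖u‖ * τ)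
        (f := fun x => u x * (q.eval (w x) * (arcCutoff δ (w x) - 1 : ℝ)) * cantorPt x ^ n)
        (.of_forall fun x => ?_)
      · simpa using this
      · rw [norm_mul, norm_mul, norm_pow, norm_cantorPt, one_pow, mul_one]
        refine mul_le_mul (u.norm_coe_le_norm x) ?_ (norm_nonneg _) (norm_nonneg _)
        rcases le_total ‖w x - 1‖ (δ / 2) with h1 | h1
        · simp [arcCutoff_eq_one hδ h1, hτ.le]
        · rw [norm_mul, norm_real, Real.norm_eq_abs]
          exact (mul_le_of_le_one_right (norm_nonneg _) (abs_arcCutoff_sub_one_le _ _)).trans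
            (hq _ (hwn x) h1)
    have hb₂ : ‖∑ k ∈ Finset.range D, ∫ x, q.coeff (k + 1) *
        (v k x * cantorPt x ^ (N * (k + 1) + n)) ∂cantorMeasure‖ ≤ B * (ε / (2 * (B + 1))) := by
      rw [hB, Finset.sum_mul]
      refine norm_sum_le_of_le _ fun k hk => ?_
      rw [integral_const_mul, norm_mul]
      gcongr
      refine (hN₁ _ ?_ k hk).le
      calc N₁ ≤ N := le_max_right _ _
        _ ≤ N * (k + 1) := Nat.le_mul_of_pos_right _ (by omega)
        _ ≤ _ := Nat.le_add_right _ _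
    have hc₁ : ‖u‖ * τ ≤ ε / 2 := by
      rw [hτd, ← mul_div_assoc, div_le_div_iff₀ (by positivity) (by positivity)]
      nlinarith [norm_nonneg u]
    have hc₂ : B * (ε / (2 * (B + 1))) ≤ ε / 2 := by
      rw [← mul_div_assoc, div_le_div_iff₀ (by positivity) (by positivity)]
      nlinarith
    linarith

/-- The pairing of a function on the disk with the measure `u dμ` on the perfect set. -/
def cantorPairing (u : C(ℕ → Bool, ℂ)) (f : ℂ → ℂ) : ℂ :=
  ∫ x, u x * f (cantorPt x) ∂cantorMeasure

theorem continuous_comp_cantorPt {f : ℂ → ℂ} (hf : f ∈ APlus) :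
    Continuous fun x => f (cantorPt x) :=
  (continuousOn_of_mem_APlus hf).comp_continuous continuous_cantorPt fun x => by
    simp [norm_cantorPt]

theorem integrable_mul_comp_cantorPt (u : C(ℕ → Bool, ℂ)) {f : ℂ → ℂ} (hf : f ∈ APlus) :
    Integrable (fun x => u x * f (cantorPt x)) cantorMeasure :=
  integrable_of_continuous_cantor (u.continuous.mul (continuous_comp_cantorPt hf)) _

theorem norm_cantorPairing_le_of_coeff {u : C(ℕ → Bool, ℂ)} {ε : ℝ}
    (hu : ∀ n : ℕ, ‖∫ x, u x * cantorPt x ^ n ∂cantorMeasure‖ ≤ ε) {f : ℂ → ℂ} (hf : f ∈ APlus) :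
    ‖cantorPairing u f‖ ≤ ε * APlusNorm f := by
  obtain ⟨a, ha⟩ : ∃ a, HasTaylor f a := ⟨_, hasTaylor_of_mem hf⟩
  have hcont := continuous_cantorPt
  have hn : ∀ n x, ‖u x * (a n * cantorPt x ^ n)‖ ≤ ‖u‖ * ‖a n‖ := fun n x => by
    rw [norm_mul, norm_mul, norm_pow, norm_cantorPt, one_pow, mul_one]
    gcongr
    exact u.norm_coe_le_norm x
  have hi : ∀ n, Integrable (fun x => u x * (a n * cantorPt x ^ n)) cantorMeasure := fun n =>
    integrable_of_continuous_cantor (by fun_prop) _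
  have h := hasSum_integral_of_summable_integral_norm hi
    ((ha.1.mul_left ‖u‖).of_nonneg_of_le (fun n => integral_nonneg fun x => norm_nonneg _)
      fun n => by
        simpa using integral_mono (hi n).norm (integrable_const (‖u‖ * ‖a n‖)) (hn n))
  have hx : ∀ x, ∑' n, u x * (a n * cantorPt x ^ n) = u x * f (cantorPt x) := fun x =>
    ((ha.2 _ (by simp [norm_cantorPt])).mul_left _).tsum_eq
  simp_rw [hx] at h
  rw [cantorPairing, ← h.tsum_eq, ha.norm_eq, ← tsum_mul_left]
  refine tsum_of_norm_bounded (ha.1.mul_left ε).hasSum fun n => ?_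
  have : ∀ x, u x * (a n * cantorPt x ^ n) = a n * (u x * cantorPt x ^ n) := fun x => by ring
  simp_rw [this]
  rw [integral_const_mul, norm_mul, mul_comm]
  gcongr
  exact hu n

theorem norm_cantorPairing_le (u : C(ℕ → Bool, ℂ)) {f : ℂ → ℂ} {c : ℝ}
    (hc : ∀ x, ‖u x * f (cantorPt x)‖ ≤ c) : ‖cantorPairing u f‖ ≤ c := by
  rw [cantorPairing]
  simpa using norm_integral_le_of_norm_le_const (μ := cantorMeasure) (.of_forall hc)

theorem cantorPairing_add (u : C(ℕ → Bool, ℂ)) {f g : ℂ → ℂ} (hf : f ∈ APlus) (hg : g ∈ APlus) :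
    cantorPairing u (fun z => f z + g z) = cantorPairing u f + cantorPairing u g := by
  simp only [cantorPairing, mul_add]
  exact integral_add (integrable_mul_comp_cantorPt u hf) (integrable_mul_comp_cantorPt u hg)

theorem cantorPairing_sub (u : C(ℕ → Bool, ℂ)) {f g : ℂ → ℂ} (hf : f ∈ APlus) (hg : g ∈ APlus) :
    cantorPairing u (fun z => f z - g z) = cantorPairing u f - cantorPairing u g := by
  simp only [cantorPairing, mul_sub]
  exact integral_sub (integrable_mul_comp_cantorPt u hf) (integrable_mul_comp_cantorPt u hg)

theorem exists_localized_pairing_ne_zero (u : C(ℕ → Bool, ℂ)) (m : ℕ) {x : ℕ → Bool}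
    (hx : u x ≠ 0) : ∃ e ∈ APlus, ∃ v ∈ APlus, (∀ y ∉ PiNat.cylinder x m, e (cantorPt y) = 0) ∧
      cantorPairing u (fun z => e z * e z * v z) ≠ 0 := by
  obtain ⟨e, he, he0, he1⟩ := exists_localizer x m
  have hec := continuous_comp_cantorPt he
  set g : C(ℕ → Bool, ℂ) := ⟨fun y => u y * (e (cantorPt y) * e (cantorPt y)), u.continuous.mul (hec.mul hec)⟩
    with hg
  have hgx : g x ≠ 0 := by
    have := he1 x (PiNat.self_mem_cylinder x m)
    simp [hg, hx, this]
  have hcn : Continuous fun y => ‖g y‖ ^ 2 := by fun_prop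
  have hpos : 0 < ∫ y, ‖g y‖ ^ 2 ∂cantorMeasure :=
    hcn.integral_pos_of_hasCompactSupport_nonneg_nonzero (HasCompactSupport.of_compactSpace _)
      (fun y => by positivity) (x := x) (by positivity)
  set a := ∫ y, ‖g y‖ ^ 2 ∂cantorMeasure with ha
  obtain ⟨p, hp⟩ := exists_polynomial_near (⟨fun y => (starRingEnd ℂ) (g y), by fun_prop⟩)
    (show 0 < a / (2 * (‖g‖ + 1)) by positivity)
  simp only [ContinuousMap.coe_mk] at hp
  refine ⟨e, he, fun z => p.eval z, polynomial_mem_APlus p, he0, fun h0 => ?_⟩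
  have hpc := p.continuous
  have hcont := continuous_cantorPt
  have h1 : cantorPairing u (fun z => e z * e z * p.eval z) =
      (a : ℂ) - ∫ y, g y * ((starRingEnd ℂ) (g y) - p.eval (cantorPt y)) ∂cantorMeasure := by
    rw [ha, ← integral_complex_ofReal, ← integral_sub, cantorPairing]
    · refine integral_congr_ae (.of_forall fun y => ?_)
      beta_reduce
      rw [mul_sub, mul_conj, normSq_eq_norm_sq, sub_sub_cancel]
      simp only [hg, ContinuousMap.coe_mk]
      ring
    · exact integrable_of_continuous_cantor (by fun_prop) _
    · exact integrable_of_continuous_cantor (by fun_prop) _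
  have h2 : ‖∫ y, g y * ((starRingEnd ℂ) (g y) - p.eval (cantorPt y)) ∂cantorMeasure‖ ≤
      ‖g‖ * (a / (2 * (‖g‖ + 1))) := by
    have := norm_integral_le_of_norm_le_const (μ := cantorMeasure)
      (f := fun y => g y * ((starRingEnd ℂ) (g y) - p.eval (cantorPt y)))
      (C := ‖g‖ * (a / (2 * (‖g‖ + 1)))) (.of_forall fun y => ?_)
    · simpa using this
    · rw [norm_mul]
      exact mul_le_mul (g.norm_coe_le_norm y) (hp y).le (norm_nonneg _) (norm_nonneg _)
  rw [h0, eq_comm, sub_eq_zero] at h1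
  rw [← h1, norm_real, Real.norm_eq_abs, abs_of_pos hpos, ← mul_div_assoc,
    le_div_iff₀ (by positivity)] at h2
  nlinarith [norm_nonneg g]

/-- Every cylinder of depth `m` met by the support of `u` carries a localized function whose
pairing with `u` is not small. -/
def IsDetected (u : C(ℕ → Bool, ℂ)) (m : ℕ) (ε : ℝ) : Prop :=
  ∀ x, u x ≠ 0 → ∃ e ∈ APlus, ∃ v ∈ APlus, (∀ y ∉ PiNat.cylinder x m, e (cantorPt y) = 0) ∧
    ε * APlusNorm (fun z => e z * e z * v z) < ‖cantorPairing u (fun z => e z * e z * v z)‖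

theorem mul_mul_mem_APlus {e v : ℂ → ℂ} (he : e ∈ APlus) (hv : v ∈ APlus) :
    (fun z => e z * e z * v z) ∈ APlus :=
  mul_mem_APlus (mul_mem_APlus he he) hv

theorem exists_isDetected (u : C(ℕ → Bool, ℂ)) (m : ℕ) {η : ℝ} (hη : 0 < η) :
    ∃ ε, 0 < ε ∧ ε ≤ η ∧ IsDetected u m ε := by
  have key : ∃ ε, 0 < ε ∧ ε ≤ η ∧ ∀ x ∈ (univ : Set (ℕ → Bool)), u x ≠ 0 →
      ∃ e ∈ APlus, ∃ v ∈ APlus, (∀ y ∉ PiNat.cylinder x m, e (cantorPt y) = 0) ∧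
      ε * APlusNorm (fun z => e z * e z * v z) <
        ‖cantorPairing u (fun z => e z * e z * v z)‖ := by
    refine (isCompact_univ (X := ℕ → Bool)).induction_on ⟨η, hη, le_rfl, by simp⟩
      (fun s t hst ⟨ε, h1, h2, h3⟩ => ⟨ε, h1, h2, fun x hx => h3 x (hst hx)⟩) ?_ ?_
    · rintro s t ⟨ε, h1, h2, h3⟩ ⟨ε', h1', h2', h3'⟩
      refine ⟨min ε ε', lt_min h1 h1', (min_le_left _ _).trans h2, fun x hx hux => ?_⟩
      rcases hx with hx | hx
      · obtain ⟨e, he, v, hv, h4, h5⟩ := h3 x hx hux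
        refine ⟨e, he, v, hv, h4, lt_of_le_of_lt ?_ h5⟩
        exact mul_le_mul_of_nonneg_right (min_le_left _ _) (APlusNorm_nonneg _)
      · obtain ⟨e, he, v, hv, h4, h5⟩ := h3' x hx hux
        refine ⟨e, he, v, hv, h4, lt_of_le_of_lt ?_ h5⟩
        exact mul_le_mul_of_nonneg_right (min_le_right _ _) (APlusNorm_nonneg _)
    · intro x _
      refine ⟨PiNat.cylinder x m, mem_nhdsWithin_of_mem_nhds
        ((PiNat.isOpen_cylinder (fun _ => Bool) x m).mem_nhds (PiNat.self_mem_cylinder x m)), ?_⟩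
      by_cases h : ∃ y ∈ PiNat.cylinder x m, u y ≠ 0
      · obtain ⟨y, hy, huy⟩ := h
        obtain ⟨e, he, v, hv, h4, h5⟩ := exists_localized_pairing_ne_zero u m huy
        have h6 : 0 < ‖cantorPairing u (fun z => e z * e z * v z)‖ := norm_pos_iff.2 h5
        have h7 := APlusNorm_nonneg (fun z => e z * e z * v z)
        refine ⟨min η (‖cantorPairing u (fun z => e z * e z * v z)‖ /
          (2 * (APlusNorm (fun z => e z * e z * v z) + 1))), lt_min hη (by positivity),
          min_le_left _ _, fun x' hx' _ => ⟨e, he, v, hv, fun y' hy' => h4 y' ?_, ?_⟩⟩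
        · rwa [PiNat.mem_cylinder_iff_eq.1 hy, ← PiNat.mem_cylinder_iff_eq.1 hx']
        · refine (mul_le_mul_of_nonneg_right (min_le_right _ _) h7).trans_lt ?_
          rw [div_mul_eq_mul_div, div_lt_iff₀ (by positivity)]
          nlinarith
      · push Not at h
        exact ⟨η, hη, le_rfl, fun y hy hne => absurd (h y hy) hne⟩
  obtain ⟨ε, h1, h2, h3⟩ := key
  exact ⟨ε, h1, h2, fun x => h3 x (mem_univ x)⟩

theorem exists_ne_mem_of_isOpen {s : Set (ℕ → Bool)} (hs : IsOpen s) {x : ℕ → Bool} (hx : x ∈ s) :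
    ∃ y ∈ s, y ≠ x := by
  obtain ⟨n, hn⟩ := PiNat.isTopologicalBasis_cylinders (fun _ => Bool) |>.mem_nhds_iff.1
    (hs.mem_nhds hx)
  obtain ⟨⟨x', n, rfl⟩, hx', hsub⟩ := hn
  refine ⟨Function.update x n (!x n), hsub fun i hi => ?_, fun h => ?_⟩
  · rw [Function.update_of_ne hi.ne, hx' i hi]
  · have := congrFun h n
    simp at this

theorem exists_splitting_depth (u : C(ℕ → Bool, ℂ)) (m : ℕ) : ∃ M, ∀ m' ≥ M, ∀ x, u x ≠ 0 →
    ∃ y ∈ PiNat.cylinder x m, u y ≠ 0 ∧ y ∉ PiNat.cylinder x m' := by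
  have key : ∃ M, ∀ m' ≥ M, ∀ x ∈ (univ : Set (ℕ → Bool)), u x ≠ 0 →
      ∃ y ∈ PiNat.cylinder x m, u y ≠ 0 ∧ y ∉ PiNat.cylinder x m' := by
    refine (isCompact_univ (X := ℕ → Bool)).induction_on ⟨0, by simp⟩
      (fun s t hst ⟨M, h⟩ => ⟨M, fun m' hm' x hx => h m' hm' x (hst hx)⟩) ?_ ?_
    · rintro s t ⟨M, h⟩ ⟨M', h'⟩
      refine ⟨max M M', fun m' hm' x hx => ?_⟩
      rcases hx with hx | hx
      · exact h m' (le_of_max_le_left hm') x hx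
      · exact h' m' (le_of_max_le_right hm') x hx
    · intro x _
      refine ⟨PiNat.cylinder x m, mem_nhdsWithin_of_mem_nhds
        ((PiNat.isOpen_cylinder (fun _ => Bool) x m).mem_nhds (PiNat.self_mem_cylinder x m)), ?_⟩
      by_cases h : ∃ y ∈ PiNat.cylinder x m, u y ≠ 0
      · obtain ⟨y, hy, huy⟩ := h
        obtain ⟨y', ⟨hy', huy'⟩, hne⟩ := exists_ne_mem_of_isOpen
          ((PiNat.isOpen_cylinder (fun _ => Bool) x m).inter
            (isOpen_ne_fun u.continuous continuous_const)) ⟨hy, huy⟩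
        obtain ⟨i, hi⟩ := Function.ne_iff.1 hne
        refine ⟨i + 1, fun m' hm' w hw _ => ?_⟩
        rw [← PiNat.mem_cylinder_iff_eq.1 hw] at hy hy'
        by_cases hyw : y ∈ PiNat.cylinder w m'
        · refine ⟨y', hy', huy', fun h => hi ?_⟩
          rw [h i (by omega), hyw i (by omega)]
        · exact ⟨y, hy, huy, hyw⟩
      · push Not at h
        exact ⟨0, fun _ _ y hy hne => absurd (h y hy) hne⟩
  obtain ⟨M, h⟩ := key
  exact ⟨M, fun m' hm' x => h m' hm' x (mem_univ x)⟩

/-- Passing from one density to the next while forcing its support to be thinner. -/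
structure IsThinning (h : C(ℕ → Bool, Circle)) (j : ℕ) (u : C(ℕ → Bool, ℂ)) (m : ℕ) (ε : ℝ)
    (u' : C(ℕ → Bool, ℂ)) (m' : ℕ) (ε' : ℝ) : Prop where
  support : ∀ x, u' x ≠ 0 → u x ≠ 0
  near : ∃ N ≥ j, ∀ x, u' x ≠ 0 → ‖cantorPt x ^ N - h x‖ ≤ 1 / ((j : ℝ) + 1)
  coeff : ∀ n : ℕ, ‖∫ x, (u' x - u x) * cantorPt x ^ n ∂cantorMeasure‖ ≤ ε / 2
  eps_le : ε' ≤ ε / 2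
  small : ‖u'‖ * (2 / 9) ^ m' ≤ 1 / ((j : ℝ) + 1)
  split : ∀ x, u' x ≠ 0 → ∃ y ∈ PiNat.cylinder x m, u' y ≠ 0 ∧ y ∉ PiNat.cylinder x m'

theorem exists_isThinning (h : C(ℕ → Bool, Circle)) (j : ℕ) (u : C(ℕ → Bool, ℂ)) (m : ℕ) {ε : ℝ}
    (hε : 0 < ε) : ∃ u' m' ε', 0 < ε' ∧ IsDetected u' m' ε' ∧ IsThinning h j u m ε u' m' ε' := by
  obtain ⟨N, hN, u', h1, h2⟩ := exists_thin_step u h (half_pos hε)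
    (show 0 < 1 / ((j : ℝ) + 1) by positivity) j
  obtain ⟨M, hM⟩ := exists_splitting_depth u' m
  have h3 : Tendsto (fun k : ℕ => ‖u'‖ * (2 / 9 : ℝ) ^ k) atTop (nhds (‖u'‖ * 0)) :=
    (tendsto_pow_atTop_nhds_zero_of_lt_one (by norm_num) (by norm_num)).const_mul _
  rw [mul_zero] at h3
  obtain ⟨m', hm', hMm'⟩ := ((h3.eventually (gt_mem_nhds
    (show 0 < 1 / ((j : ℝ) + 1) by positivity))).and (eventually_ge_atTop M)).exists
  obtain ⟨ε', h4, h5, h6⟩ := exists_isDetected u' m' (half_pos hε)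
  exact ⟨u', m', ε', h4, h6, fun x hx => (h1 x hx).1, ⟨N, hN, fun x hx => (h1 x hx).2⟩, h2, h5,
    hm'.le, hM m' hMm'⟩

/-- A sequence of densities whose supports shrink to a thin set. -/
structure IsThinSequence (H : ℕ → C(ℕ → Bool, Circle)) (u : ℕ → C(ℕ → Bool, ℂ)) (m : ℕ → ℕ)
    (ε : ℕ → ℝ) : Prop where
  nontrivial : ∃ x, u 0 x ≠ 0
  eps_pos : ∀ j, 0 < ε j
  detected : ∀ j, IsDetected (u j) (m j) (ε j)
  thinning : ∀ j, IsThinning (H j) j (u j) (m j) (ε j) (u (j + 1)) (m (j + 1)) (ε (j + 1))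

theorem exists_isThinSequence (H : ℕ → C(ℕ → Bool, Circle)) :
    ∃ u m ε, IsThinSequence H u m ε := by
  let T := {t : C(ℕ → Bool, ℂ) × ℕ × ℝ // 0 < t.2.2 ∧ IsDetected t.1 t.2.1 t.2.2}
  have step : ∀ (j : ℕ) (t : T), ∃ t' : T, IsThinning (H j) j t.1.1 t.1.2.1 t.1.2.2
      t'.1.1 t'.1.2.1 t'.1.2.2 := fun j t => by
    obtain ⟨u', m', ε', h1, h2, h3⟩ := exists_isThinning (H j) j t.1.1 t.1.2.1 t.2.1
    exact ⟨⟨(u', m', ε'), h1, h2⟩, h3⟩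
  choose next hnext using step
  obtain ⟨ε₀, h1, -, h2⟩ := exists_isDetected 1 0 one_pos
  let s : ℕ → T := fun n => Nat.rec ⟨(1, 0, ε₀), h1, h2⟩ next n
  exact ⟨fun j => (s j).1.1, fun j => (s j).1.2.1, fun j => (s j).1.2.2,
    ⟨fun _ => false, by simp [s]⟩, fun j => (s j).2.1, fun j => (s j).2.2, fun j => hnext j (s j)⟩

/-- The limit of the pairings along a sequence of densities. -/
def limitPairing (u : ℕ → C(ℕ → Bool, ℂ)) (f : ℂ → ℂ) : ℂ :=
  limUnder atTop fun j => cantorPairing (u j) f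

/-- The intersection of the supports of a sequence of densities. -/
def limitSupport (u : ℕ → C(ℕ → Bool, ℂ)) : Set (ℕ → Bool) := ⋂ j, closure {x | u j x ≠ 0}

namespace IsThinSequence

variable {H : ℕ → C(ℕ → Bool, Circle)} {u : ℕ → C(ℕ → Bool, ℂ)} {m : ℕ → ℕ} {ε : ℕ → ℝ}

theorem norm_pairing_succ_sub_le (hu : IsThinSequence H u m ε) {f : ℂ → ℂ} (hf : f ∈ APlus)
    (j : ℕ) : ‖cantorPairing (u (j + 1)) f - cantorPairing (u j) f‖ ≤ ε j / 2 * APlusNorm f := by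
  have h1 : cantorPairing (u (j + 1)) f - cantorPairing (u j) f =
      cantorPairing (u (j + 1) - u j) f := by
    simp only [cantorPairing, ContinuousMap.coe_sub, Pi.sub_apply, sub_mul]
    exact (integral_sub (integrable_mul_comp_cantorPt _ hf)
      (integrable_mul_comp_cantorPt _ hf)).symm
  rw [h1]
  exact norm_cantorPairing_le_of_coeff (fun n => (hu.thinning j).coeff n) hf

theorem norm_pairing_sub_le (hu : IsThinSequence H u m ε) {f : ℂ → ℂ} (hf : f ∈ APlus)
    (j k : ℕ) : ‖cantorPairing (u (j + k)) f - cantorPairing (u j) f‖ ≤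
      (ε j - ε (j + k)) * APlusNorm f := by
  induction k with
  | zero => simp
  | succ k ih =>
    have h1 := hu.norm_pairing_succ_sub_le hf (j + k)
    have h2 := (hu.thinning (j + k)).eps_le
    have h3 := APlusNorm_nonneg f
    calc _ = ‖(cantorPairing (u (j + k + 1)) f - cantorPairing (u (j + k)) f) +
          (cantorPairing (u (j + k)) f - cantorPairing (u j) f)‖ := by
          congr 1; rw [← add_assoc]; ring
      _ ≤ _ := norm_add_le _ _
      _ ≤ ε (j + k) / 2 * APlusNorm f + (ε j - ε (j + k)) * APlusNorm f := add_le_add h1 ih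
      _ = (ε j - ε (j + k) / 2) * APlusNorm f := by ring
      _ ≤ _ := by gcongr; exact h2

theorem norm_pairing_sub_le' (hu : IsThinSequence H u m ε) {f : ℂ → ℂ} (hf : f ∈ APlus)
    {j k : ℕ} (hjk : j ≤ k) : ‖cantorPairing (u k) f - cantorPairing (u j) f‖ ≤
      ε j * APlusNorm f := by
  obtain ⟨k, rfl⟩ := Nat.exists_eq_add_of_le hjk
  refine (hu.norm_pairing_sub_le hf j k).trans ?_
  have := hu.eps_pos (j + k)
  have h3 := APlusNorm_nonneg f
  gcongr
  linarith

theorem eps_tendsto (hu : IsThinSequence H u m ε) : Tendsto ε atTop (nhds 0) := by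
  have h1 : ∀ j, ε j ≤ ε 0 * (1 / 2) ^ j := fun j => by
    induction j with
    | zero => simp
    | succ j ih =>
      rw [pow_succ]
      have := (hu.thinning j).eps_le
      linarith
  refine squeeze_zero (fun j => (hu.eps_pos j).le) h1 ?_
  simpa using (tendsto_pow_atTop_nhds_zero_of_lt_one (r := (1 / 2 : ℝ)) (by norm_num)
    (by norm_num)).const_mul (ε 0)

theorem tendsto_limitPairing (hu : IsThinSequence H u m ε) {f : ℂ → ℂ} (hf : f ∈ APlus) :
    Tendsto (fun j => cantorPairing (u j) f) atTop (nhds (limitPairing u f)) := by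
  refine tendsto_nhds_limUnder (cauchySeq_tendsto_of_complete ?_)
  refine cauchySeq_of_le_tendsto_0' (fun j => ε j * APlusNorm f) (fun j k hjk => ?_) ?_
  · rw [dist_comm, dist_eq_norm]
    exact hu.norm_pairing_sub_le' hf hjk
  · simpa using hu.eps_tendsto.mul_const (APlusNorm f)

theorem norm_limitPairing_sub_le (hu : IsThinSequence H u m ε) {f : ℂ → ℂ} (hf : f ∈ APlus)
    (j : ℕ) : ‖limitPairing u f - cantorPairing (u j) f‖ ≤ ε j * APlusNorm f :=
  le_of_tendsto ((hu.tendsto_limitPairing hf).sub_const _).norm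
    (eventually_atTop.2 ⟨j, fun _ hk => hu.norm_pairing_sub_le' hf hk⟩)

theorem norm_limitPairing_le (hu : IsThinSequence H u m ε) {f : ℂ → ℂ} (hf : f ∈ APlus) :
    ‖limitPairing u f‖ ≤ (ε 0 + ‖u 0‖) * APlusNorm f := by
  have h1 := hu.norm_limitPairing_sub_le hf 0
  have h2 : ‖cantorPairing (u 0) f‖ ≤ ‖u 0‖ * APlusNorm f := by
    refine norm_cantorPairing_le _ fun x => ?_
    rw [norm_mul]
    exact mul_le_mul ((u 0).norm_coe_le_norm x) (norm_le_APlusNorm hf (norm_cantorPt x).le)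
      (norm_nonneg _) (norm_nonneg _)
  have h3 := norm_sub_norm_le (limitPairing u f) (cantorPairing (u 0) f)
  rw [add_mul]
  linarith

theorem limitPairing_add (hu : IsThinSequence H u m ε) {f g : ℂ → ℂ} (hf : f ∈ APlus)
    (hg : g ∈ APlus) :
    limitPairing u (fun z => f z + g z) = limitPairing u f + limitPairing u g := by
  refine tendsto_nhds_unique (hu.tendsto_limitPairing (add_mem_APlus hf hg)) ?_
  refine ((hu.tendsto_limitPairing hf).add (hu.tendsto_limitPairing hg)).congr fun j => ?_
  exact (cantorPairing_add _ hf hg).symm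

theorem limitPairing_sub (hu : IsThinSequence H u m ε) {f g : ℂ → ℂ} (hf : f ∈ APlus)
    (hg : g ∈ APlus) :
    limitPairing u (fun z => f z - g z) = limitPairing u f - limitPairing u g := by
  refine tendsto_nhds_unique (hu.tendsto_limitPairing (sub_mem_APlus hf hg)) ?_
  refine ((hu.tendsto_limitPairing hf).sub (hu.tendsto_limitPairing hg)).congr fun j => ?_
  exact (cantorPairing_sub _ hf hg).symm

theorem limitPairing_eq_zero (hu : IsThinSequence H u m ε) {f : ℂ → ℂ} (hf : f ∈ APlus)
    (h0 : ∀ x, f (cantorPt x) = 0) : limitPairing u f = 0 := by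
  refine tendsto_nhds_unique (hu.tendsto_limitPairing hf) ?_
  simp [cantorPairing, h0]

theorem limitPairing_mul_pow_tendsto (hu : IsThinSequence H u m ε) {f : ℂ → ℂ} (hf : f ∈ APlus) :
    Tendsto (fun n : ℕ => limitPairing u (fun z => f z * z ^ n)) atTop (nhds 0) := by
  rw [Metric.tendsto_atTop]
  intro η hη
  have h1 : Tendsto (fun j => ε j * APlusNorm f) atTop (nhds 0) := by
    simpa using hu.eps_tendsto.mul_const (APlusNorm f)
  obtain ⟨j, hj⟩ := (h1.eventually (gt_mem_nhds (half_pos hη))).exists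
  have h2 := integral_mul_cantorPt_pow_tendsto
    ⟨fun x => u j x * f (cantorPt x), (u j).continuous.mul (continuous_comp_cantorPt hf)⟩
  obtain ⟨N, hN⟩ := (Metric.tendsto_atTop.1 h2) _ (half_pos hη)
  refine ⟨N, fun n hn => ?_⟩
  have h3 := hN n hn
  rw [dist_zero_right] at h3 ⊢
  have hfn : (fun z : ℂ => f z * z ^ n) ∈ APlus := mul_mem_APlus hf (pow_mem_APlus n)
  have h4 := hu.norm_limitPairing_sub_le hfn j
  have h5 : APlusNorm (fun z : ℂ => f z * z ^ n) ≤ APlusNorm f := by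
    refine (APlusNorm_mul_le hf (pow_mem_APlus n)).trans ?_
    rw [APlusNorm_pow, mul_one]
  have h6 : ε j * APlusNorm (fun z : ℂ => f z * z ^ n) ≤ ε j * APlusNorm f :=
    mul_le_mul_of_nonneg_left h5 (hu.eps_pos j).le
  have h7 : cantorPairing (u j) (fun z : ℂ => f z * z ^ n) =
      ∫ x, (u j x * f (cantorPt x)) * cantorPt x ^ n ∂cantorMeasure := by
    simp only [cantorPairing, mul_assoc]
  have h8 := norm_sub_norm_le (limitPairing u fun z => f z * z ^ n)
    (cantorPairing (u j) (fun z : ℂ => f z * z ^ n))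
  simp only [ContinuousMap.coe_mk] at h3
  rw [h7] at h8 h4
  linarith

theorem support_antitone (hu : IsThinSequence H u m ε) {j k : ℕ} (hjk : j ≤ k) {x : ℕ → Bool}
    (hx : u k x ≠ 0) : u j x ≠ 0 := by
  induction k, hjk using Nat.le_induction with
  | base => exact hx
  | succ k _ ih => exact ih ((hu.thinning k).support x hx)

/-- A cylinder met by the support of a density carries a localized function detected by the limit. -/
theorem exists_localized (hu : IsThinSequence H u m ε) {j : ℕ} {x : ℕ → Bool} (hx : u j x ≠ 0) :
    ∃ e ∈ APlus, ∃ v ∈ APlus, (∀ y ∉ PiNat.cylinder x (m j), e (cantorPt y) = 0) ∧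
      limitPairing u (fun z => e z * e z * v z) ≠ 0 ∧
      ∀ k ≥ j, ∃ y ∈ PiNat.cylinder x (m j), u k y ≠ 0 := by
  obtain ⟨e, he, v, hv, h1, h2⟩ := hu.detected j x hx
  have hm := mul_mul_mem_APlus he hv
  refine ⟨e, he, v, hv, h1, fun h0 => ?_, fun k hk => ?_⟩
  · have := hu.norm_limitPairing_sub_le hm j
    rw [h0, zero_sub, norm_neg] at this
    linarith
  · by_contra! h3
    have h4 : cantorPairing (u k) (fun z => e z * e z * v z) = 0 := by
      refine integral_eq_zero_of_ae (.of_forall fun y => ?_)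
      by_cases hy : y ∈ PiNat.cylinder x (m j)
      · simp [h3 y hy]
      · simp [h1 y hy]
    have := hu.norm_pairing_sub_le' hm hk
    rw [h4, zero_sub, norm_neg] at this
    linarith

theorem isClosed_limitSupport (u : ℕ → C(ℕ → Bool, ℂ)) : IsClosed (limitSupport u) :=
  isClosed_iInter fun _ => isClosed_closure

theorem cylinder_inter_limitSupport_nonempty (hu : IsThinSequence H u m ε) {j : ℕ}
    {x : ℕ → Bool} (hx : u j x ≠ 0) :
    (PiNat.cylinder x (m j) ∩ limitSupport u).Nonempty := by
  obtain ⟨e, he, v, hv, -, -, h⟩ := hu.exists_localized hx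
  have hB : IsClosed (PiNat.cylinder x (m j)) := by
    rw [PiNat.cylinder_eq_pi]
    exact isClosed_set_pi fun a _ => isClosed_discrete _
  have h1 : (⋂ k, PiNat.cylinder x (m j) ∩ closure {x | u k x ≠ 0}).Nonempty := by
    refine IsCompact.nonempty_iInter_of_sequence_nonempty_isCompact_isClosed _ (fun k => ?_)
      (fun k => ?_) (hB.inter isClosed_closure).isCompact fun k => hB.inter isClosed_closure
    · exact inter_subset_inter_right _ (closure_mono fun y => (hu.thinning k).support y)
    · obtain ⟨y, hy, hy'⟩ := h (max j k) (le_max_left _ _)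
      exact ⟨y, hy, subset_closure (hu.support_antitone (le_max_right _ _) hy')⟩
  rwa [← inter_iInter] at h1

theorem limitSupport_nonempty (hu : IsThinSequence H u m ε) : (limitSupport u).Nonempty := by
  obtain ⟨x, hx⟩ := hu.nontrivial
  exact (hu.cylinder_inter_limitSupport_nonempty hx).mono inter_subset_right

/-- The limit functional kills Lipschitz functions vanishing on the limit support. -/
theorem limitPairing_mul_eq_zero (hu : IsThinSequence H u m ε) {f v : ℂ → ℂ} (hf : f ∈ APlus)
    (hv : v ∈ APlus) {L : ℝ} (hL : ∀ z w, ‖z‖ ≤ 1 → ‖w‖ ≤ 1 → ‖f z - f w‖ ≤ L * ‖z - w‖)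
    (h0 : ∀ x ∈ limitSupport u, f (cantorPt x) = 0) :
    limitPairing u (fun z => f z * v z) = 0 := by
  have hfv : (fun z => f z * v z) ∈ APlus := mul_mem_APlus hf hv
  have hL0 : 0 ≤ L := by
    have := (norm_nonneg _).trans (hL 0 1 (by simp) (by simp))
    simpa using this
  refine tendsto_nhds_unique ((hu.tendsto_limitPairing hfv).comp (tendsto_add_atTop_nat 1)) ?_
  refine squeeze_zero_norm (a := fun j : ℕ => 1 / ((j : ℝ) + 1) * (L * APlusNorm v))
    (fun j => ?_) ?_
  · refine norm_cantorPairing_le (u (j + 1)) (f := fun z => f z * v z) fun x => ?_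
    have hv0 := APlusNorm_nonneg v
    by_cases hx : u (j + 1) x = 0
    · rw [hx, zero_mul, norm_zero]
      positivity
    · obtain ⟨y, hy, hys⟩ := hu.cylinder_inter_limitSupport_nonempty hx
      have h1 := hL (cantorPt x) (cantorPt y) (norm_cantorPt _).le (norm_cantorPt _).le
      rw [h0 y hys, sub_zero] at h1
      have h2 := norm_cantorPt_sub_le (PiNat.mem_cylinder_comm _ _ _ |>.1 hy)
      have h3 := norm_le_APlusNorm hv (norm_cantorPt x).le
      calc ‖u (j + 1) x * (f (cantorPt x) * v (cantorPt x))‖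
          = ‖u (j + 1) x‖ * (‖f (cantorPt x)‖ * ‖v (cantorPt x)‖) := by simp
        _ ≤ ‖u (j + 1)‖ * ((L * (2 / 9) ^ m (j + 1)) * APlusNorm v) := by
          gcongr
          · exact (u (j + 1)).norm_coe_le_norm x
          · exact h1.trans (by gcongr)
        _ = (‖u (j + 1)‖ * (2 / 9) ^ m (j + 1)) * (L * APlusNorm v) := by ring
        _ ≤ _ := by
          gcongr
          exact (hu.thinning j).small
  · simpa using tendsto_one_div_add_atTop_nhds_zero_nat.mul_const (L * APlusNorm v)

end IsThinSequence

theorem exists_circle_sequence : ∃ H : ℕ → C(ℕ → Bool, Circle),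
    ∀ (g : C(ℕ → Bool, Circle)) (ε : ℝ), 0 < ε → ∀ M, ∃ j ≥ M, ∀ x, ‖(g x : ℂ) - H j x‖ < ε := by
  refine ⟨fun j => TopologicalSpace.denseSeq _ (Nat.unpair j).1, fun g ε hε M => ?_⟩
  obtain ⟨k, hk⟩ := (TopologicalSpace.denseRange_denseSeq C(ℕ → Bool, Circle)).exists_dist_lt g hε
  refine ⟨Nat.pair k M, Nat.right_le_pair _ _, fun x => ?_⟩
  have hd : dist (g x : ℂ) (TopologicalSpace.denseSeq C(ℕ → Bool, Circle) k x : ℂ) < ε :=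
    (ContinuousMap.dist_apply_le_dist x).trans_lt hk
  simpa [dist_eq_norm] using hd

/-- Approximating, on a set, every continuous unimodular function by arbitrarily high powers. -/
def HasPowerApprox (K : Set ℂ) : Prop :=
  ∀ f : ℂ → ℂ, ContinuousOn f K → (∀ z ∈ K, ‖f z‖ = 1) →
    ∀ ε > 0, ∀ M : ℕ, ∃ n ≥ M, ∀ z ∈ K, ‖f z - z ^ n‖ < ε

theorem IsThinSequence.hasPowerApprox {H : ℕ → C(ℕ → Bool, Circle)} {u : ℕ → C(ℕ → Bool, ℂ)}
    {m : ℕ → ℕ} {δ : ℕ → ℝ} (hu : IsThinSequence H u m δ)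
    (hH : ∀ (g : C(ℕ → Bool, Circle)) (ε : ℝ), 0 < ε → ∀ M, ∃ j ≥ M, ∀ x,
      ‖(g x : ℂ) - H j x‖ < ε) :
    HasPowerApprox (cantorPt '' limitSupport u) := by
  intro f hf hf1 ε hε M
  obtain ⟨ρ, hρ1, hρ2, hρ3⟩ := PiNat.exists_retraction_of_isClosed
    (IsThinSequence.isClosed_limitSupport u) hu.limitSupport_nonempty
  have hmem : ∀ x, cantorPt (ρ x) ∈ cantorPt '' limitSupport u := fun x =>
    mem_image_of_mem _ (hρ2 ▸ mem_range_self x)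
  let g : C(ℕ → Bool, Circle) := ⟨fun x => ⟨f (cantorPt (ρ x)), mem_sphere_zero_iff_norm.2 (hf1 _ (hmem x))⟩,
    Continuous.subtype_mk (hf.comp_continuous (continuous_cantorPt.comp hρ3) hmem) _⟩
  obtain ⟨k, hk⟩ := exists_nat_one_div_lt (half_pos hε)
  obtain ⟨j, hj, hgj⟩ := hH g (ε / 2) (half_pos hε) (max M k)
  obtain ⟨N, hN, hNj⟩ := (hu.thinning j).near
  refine ⟨N, (le_max_left _ _).trans (hj.trans hN), ?_⟩
  rintro _ ⟨x, hx, rfl⟩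
  have h1 : ‖cantorPt x ^ N - H j x‖ ≤ 1 / ((j : ℝ) + 1) := by
    have hcl : IsClosed {x | ‖cantorPt x ^ N - H j x‖ ≤ 1 / ((j : ℝ) + 1)} := by
      have := continuous_cantorPt
      exact isClosed_le (by fun_prop) continuous_const
    exact hcl.closure_subset_iff.2 (fun y hy => hNj y hy) (mem_iInter.1 hx (j + 1))
  have h2 : 1 / ((j : ℝ) + 1) ≤ 1 / ((k : ℝ) + 1) := by
    have : k ≤ j := (le_max_right _ _).trans hj
    gcongr
  have h3 := hgj x
  have h4 : (g x : ℂ) = f (cantorPt x) := by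
    show f (cantorPt (ρ x)) = _
    rw [hρ1 x hx]
  rw [h4] at h3
  calc ‖f (cantorPt x) - cantorPt x ^ N‖
      = ‖(f (cantorPt x) - H j x) - (cantorPt x ^ N - H j x)‖ := by congr 1; ring
    _ ≤ _ := norm_sub_le _ _
    _ < ε := by linarith

theorem exists_unimodular_halves {K : Set ℂ} {t : ℂ → ℝ} (ht : ContinuousOn t K)
    (h1 : ∀ z ∈ K, |t z| ≤ 1) : ∃ w : ℂ → ℂ, ContinuousOn w K ∧ (∀ z ∈ K, ‖w z‖ = 1) ∧
      ∀ z ∈ K, (t z : ℂ) = 1 / 2 * w z + 1 / 2 * (starRingEnd ℂ) (w z) := by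
  refine ⟨fun z => t z + √(1 - t z ^ 2) * I, by fun_prop, fun z hz => ?_, fun z _ => ?_⟩
  · have h2 : 0 ≤ 1 - t z ^ 2 := by
      have := (sq_le_one_iff_abs_le_one _).2 (h1 z hz)
      linarith
    rw [← sq_eq_sq₀ (norm_nonneg _) zero_le_one, ← normSq_eq_norm_sq, normSq_add_mul_I,
      Real.sq_sqrt h2]
    ring
  · simp only [map_add, map_mul, conj_ofReal, conj_I]
    ring

theorem HasPowerApprox.exists_near {K : Set ℂ} (hK : HasPowerApprox K) {g : ℂ → ℂ} {B : ℝ}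
    (hB : 0 < B) (hg : ContinuousOn g K) (hgB : ∀ z ∈ K, ‖g z‖ ≤ B) :
    ∃ F ∈ APlus, APlusNorm F ≤ 2 * B ∧ ∀ z ∈ K, ‖g z - F z‖ ≤ B / 2 := by
  have hre : ∀ z ∈ K, |(g z).re / B| ≤ 1 := fun z hz => by
    rw [abs_div, abs_of_pos hB, div_le_one hB]
    exact (abs_re_le_norm _).trans (hgB z hz)
  have him : ∀ z ∈ K, |(g z).im / B| ≤ 1 := fun z hz => by
    rw [abs_div, abs_of_pos hB, div_le_one hB]
    exact (abs_im_le_norm _).trans (hgB z hz)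
  obtain ⟨w₁, hw₁, hn₁, he₁⟩ := exists_unimodular_halves (t := fun z => (g z).re / B)
    (by fun_prop) hre
  obtain ⟨w₂, hw₂, hn₂, he₂⟩ := exists_unimodular_halves (t := fun z => (g z).im / B)
    (by fun_prop) him
  obtain ⟨n₁, -, h₁⟩ := hK w₁ hw₁ hn₁ (1 / 4) (by norm_num) 0
  obtain ⟨n₂, -, h₂⟩ := hK (fun z => (starRingEnd ℂ) (w₁ z)) (by fun_prop)
    (fun z hz => by simpa using hn₁ z hz) (1 / 4) (by norm_num) 0
  obtain ⟨n₃, -, h₃⟩ := hK w₂ hw₂ hn₂ (1 / 4) (by norm_num) 0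
  obtain ⟨n₄, -, h₄⟩ := hK (fun z => (starRingEnd ℂ) (w₂ z)) (by fun_prop)
    (fun z hz => by simpa using hn₂ z hz) (1 / 4) (by norm_num) 0
  have hm : ∀ (c : ℂ) (n : ℕ), (fun z : ℂ => c * z ^ n) ∈ APlus := fun c n =>
    const_mul_mem_APlus (pow_mem_APlus n) c
  have hmn : ∀ (c : ℂ) (n : ℕ), APlusNorm (fun z : ℂ => c * z ^ n) = ‖c‖ := fun c n => by
    rw [APlusNorm_const_mul (pow_mem_APlus n), APlusNorm_pow, mul_one]
  have hc₁ : ‖(B / 2 : ℂ)‖ = B / 2 := by simp [abs_of_pos hB]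
  have hc₂ : ‖(B / 2 * I : ℂ)‖ = B / 2 := by simp [abs_of_pos hB]
  refine ⟨((fun z : ℂ => (B / 2 : ℂ) * z ^ n₁) + fun z : ℂ => (B / 2 : ℂ) * z ^ n₂) +
    ((fun z : ℂ => (B / 2 * I : ℂ) * z ^ n₃) + fun z : ℂ => (B / 2 * I : ℂ) * z ^ n₄),
    add_mem_APlus (add_mem_APlus (hm _ _) (hm _ _)) (add_mem_APlus (hm _ _) (hm _ _)), ?_,
    fun z hz => ?_⟩
  · have a₁ := APlusNorm_add_le (add_mem_APlus (hm (B / 2) n₁) (hm (B / 2) n₂))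
      (add_mem_APlus (hm (B / 2 * I) n₃) (hm (B / 2 * I) n₄))
    have a₂ := APlusNorm_add_le (hm (B / 2) n₁) (hm (B / 2) n₂)
    have a₃ := APlusNorm_add_le (hm (B / 2 * I) n₃) (hm (B / 2 * I) n₄)
    rw [hmn, hmn, hc₁] at a₂
    rw [hmn, hmn, hc₂] at a₃
    linarith
  · have hB' : (B : ℂ) ≠ 0 := by exact_mod_cast hB.ne'
    have hgz : g z = B * (((g z).re / B : ℝ) : ℂ) + B * (((g z).im / B : ℝ) : ℂ) * I := by
      conv_lhs => rw [← re_add_im (g z)]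
      push_cast
      field_simp
    have he : g z - (((fun z : ℂ => (B / 2 : ℂ) * z ^ n₁) + fun z : ℂ => (B / 2 : ℂ) * z ^ n₂) +
        ((fun z : ℂ => (B / 2 * I : ℂ) * z ^ n₃) + fun z : ℂ => (B / 2 * I : ℂ) * z ^ n₄)) z =
        (B / 2) * (w₁ z - z ^ n₁) + (B / 2) * ((starRingEnd ℂ) (w₁ z) - z ^ n₂) +
        ((B / 2 * I) * (w₂ z - z ^ n₃) + (B / 2 * I) * ((starRingEnd ℂ) (w₂ z) - z ^ n₄)) := by
      rw [hgz, he₁ z hz, he₂ z hz]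
      simp only [Pi.add_apply]
      ring
    rw [he]
    refine (norm_add_le _ _).trans ((add_le_add (norm_add_le _ _) (norm_add_le _ _)).trans ?_)
    simp only [norm_mul (B / 2 : ℂ) (_ - _), norm_mul (B / 2 * I : ℂ) (_ - _), hc₁, hc₂]
    have b₁ := (h₁ z hz).le
    have b₂ := (h₂ z hz).le
    have b₃ := (h₃ z hz).le
    have b₄ := (h₄ z hz).le
    nlinarith

theorem HasPowerApprox.exists_interpolation {K : Set ℂ} (hK : HasPowerApprox K)
    (hK1 : K ⊆ closedBall 0 1) {g : ℂ → ℂ} {B : ℝ}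
    (hB : 0 < B) (hg : ContinuousOn g K) (hgB : ∀ z ∈ K, ‖g z‖ ≤ B) :
    ∃ F ∈ APlus, APlusNorm F ≤ 4 * B ∧ ∀ z ∈ K, F z = g z := by
  have step : ∀ (g : ℂ → ℂ) (B : ℝ), (0 < B ∧ ContinuousOn g K ∧ ∀ z ∈ K, ‖g z‖ ≤ B) →
      ∃ F, F ∈ APlus ∧ APlusNorm F ≤ 2 * B ∧ ∀ z ∈ K, ‖g z - F z‖ ≤ B / 2 :=
    fun g B ⟨h1, h2, h3⟩ => hK.exists_near h1 h2 h3
  choose! F hF1 hF2 hF3 using step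
  let G : ℕ → ℂ → ℂ := fun k => Nat.rec g (fun k f z => f z - F f (B * (1 / 2) ^ k) z) k
  have hG : ∀ k, 0 < B * (1 / 2) ^ k ∧ ContinuousOn (G k) K ∧
      ∀ z ∈ K, ‖G k z‖ ≤ B * (1 / 2) ^ k := fun k => by
    induction k with
    | zero => exact ⟨by simpa using hB, hg, by simpa [G] using hgB⟩
    | succ k ih =>
      refine ⟨by positivity,
        ih.2.1.sub ((continuousOn_of_mem_APlus (hF1 _ _ ih)).mono hK1), fun z hz => ?_⟩
      refine (hF3 _ _ ih z hz).trans_eq ?_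
      rw [pow_succ]
      ring
  have hsum : HasSum (fun k : ℕ => 2 * (B * (1 / 2) ^ k)) (4 * B) := by
    have := (hasSum_geometric_two.mul_left B).mul_left 2
    rwa [show 2 * (B * 2) = 4 * B by ring] at this
  have hs : Summable fun k => APlusNorm (F (G k) (B * (1 / 2) ^ k)) :=
    hsum.summable.of_nonneg_of_le (fun k => APlusNorm_nonneg _) fun k => hF2 _ _ (hG k)
  obtain ⟨h1, h2⟩ := tsum_mem_APlus (fun k => hF1 _ _ (hG k)) hs
  refine ⟨_, h1, h2.trans ?_, fun z hz => ?_⟩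
  · rw [← hsum.tsum_eq]
    exact hs.tsum_le_tsum (fun k => hF2 _ _ (hG k)) hsum.summable
  · have hsz : Summable fun k => F (G k) (B * (1 / 2) ^ k) z :=
      .of_norm (hs.of_nonneg_of_le (fun _ => norm_nonneg _) fun k =>
        norm_le_APlusNorm (hF1 _ _ (hG k)) (by simpa using hK1 hz))
    refine tendsto_nhds_unique hsz.hasSum.tendsto_sum_nat ?_
    have hpart : ∀ n, ∑ k ∈ Finset.range n, F (G k) (B * (1 / 2) ^ k) z = g z - G n z := fun n => by
      induction n with
      | zero => simp [G]
      | succ n ih =>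
        rw [Finset.sum_range_succ, ih]
        show _ = g z - (G n z - F (G n) (B * (1 / 2) ^ n) z)
        ring
    have h0 : Tendsto (fun n => G n z) atTop (nhds 0) := by
      refine squeeze_zero_norm (fun n => (hG n).2.2 z hz) ?_
      simpa using (tendsto_pow_atTop_nhds_zero_of_lt_one (r := (1 / 2 : ℝ)) (by norm_num)
        (by norm_num)).const_mul B
    simp only [hpart]
    simpa using h0.const_sub (g z)

theorem quarter_abs_le_norm_exp_sub {s t : ℝ} (hs : s ∈ Ioc (-Real.pi) Real.pi)
    (ht0 : 0 ≤ t) (ht1 : t ≤ 2 / 7) : |s - t| / 4 ≤ ‖exp (s * I) - exp (t * I)‖ := by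
  have h : exp (s * I) - exp (t * I) = exp (t * I) * (exp (I * (s - t : ℝ)) - 1) := by
    rw [mul_sub, ← exp_add]
    push_cast
    ring_nf
  rw [h, norm_mul, norm_exp_ofReal_mul_I, one_mul, norm_exp_I_mul_ofReal_sub_one, norm_mul,
    Real.norm_two, Real.norm_eq_abs]
  set b := |(s - t) / 2| with hb
  have hb0 : 0 ≤ b := abs_nonneg _
  have hbs : |s - t| = 2 * b := by rw [hb, abs_div, abs_two]; ring
  have hπ := Real.pi_gt_three
  have hπ4 := Real.pi_lt_four
  have hb2 : b ≤ Real.pi / 2 + 1 / 7 := by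
    rw [hb, abs_le]
    constructor <;> linarith [hs.1, hs.2]
  have hsin : |Real.sin ((s - t) / 2)| = Real.sin b := by
    rw [← abs_of_nonneg (Real.sin_nonneg_of_nonneg_of_le_pi hb0 (by linarith))]
    rcases abs_choice ((s - t) / 2) with h1 | h1
    · rw [hb, h1]
    · rw [hb, h1, Real.sin_neg, abs_neg]
  rw [hsin, hbs]
  have key : ∀ c, 0 ≤ c → c ≤ Real.pi / 2 → c / 2 ≤ Real.sin c := fun c h0 h1 => by
    refine le_trans ?_ (Real.mul_le_sin h0 h1)
    have : (1 : ℝ) / 2 ≤ 2 / Real.pi := by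
      rw [div_le_div_iff₀ (by norm_num) (by linarith)]; linarith
    nlinarith
  rcases le_total b (Real.pi / 2) with hb3 | hb3
  · linarith [key b hb0 hb3]
  · have := key (Real.pi - b) (by linarith) (by linarith)
    rw [Real.sin_pi_sub] at this
    linarith

/-- A cover of the angles within distance `(2/9) ^ m` of the Cantor set. -/
def cantorNhd (m : ℕ) : Set ℝ :=
  ⋃ s : Fin m → Bool, closedBall (cantorAngle fun k => if h : k < m then s ⟨k, h⟩ else false)
    (9 * (2 / 9) ^ m)

theorem measurableSet_cantorNhd (m : ℕ) : MeasurableSet (cantorNhd m) :=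
  .iUnion fun _ => measurableSet_closedBall

theorem volume_cantorNhd_le (m : ℕ) :
    volume (cantorNhd m) ≤ ENNReal.ofReal (18 * (4 / 9) ^ m) := by
  refine (measure_iUnion_le _).trans ?_
  simp only [Real.volume_closedBall, tsum_fintype, Finset.sum_const, Finset.card_univ]
  rw [Fintype.card_fun, Fintype.card_bool, Fintype.card_fin, nsmul_eq_mul,
    ← ENNReal.ofReal_natCast, ← ENNReal.ofReal_mul (by positivity)]
  refine ENNReal.ofReal_le_ofReal (le_of_eq ?_)
  push_cast
  rw [show (4 / 9 : ℝ) = 2 * (2 / 9) by norm_num, mul_pow]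
  ring

theorem mem_cantorNhd {m : ℕ} {t : ℝ} (ht : t ∈ Ioc (-Real.pi) Real.pi) {x : ℕ → Bool}
    (hx : ‖exp (t * I) - cantorPt x‖ ≤ 2 * (2 / 9) ^ m) : t ∈ cantorNhd m := by
  have h1 := (quarter_abs_le_norm_exp_sub ht (cantorAngle_nonneg x) (cantorAngle_le x)).trans hx
  refine mem_iUnion.2 ⟨fun k => x k, ?_⟩
  have h2 := abs_cantorAngle_sub_le (m := m) (x := x)
    (y := fun k => if h : k < m then x k else false) fun i hi => by simp [hi]
  have h3 : (0 : ℝ) < (2 / 9) ^ m := by positivity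
  rw [mem_closedBall, Real.dist_eq]
  refine (abs_sub_le _ (cantorAngle x) _).trans ?_
  linarith

theorem isCarleson_cantorPt_image {S : Set (ℕ → Bool)} (hS : IsClosed S) (hne : S.Nonempty) :
    IsCarleson (cantorPt '' S) := by
  have hK : IsCompact (cantorPt '' S) := hS.isCompact.image continuous_cantorPt
  have hKne : (cantorPt '' S).Nonempty := hne.image _
  refine ⟨hK.isClosed, ?_, ?_⟩
  · rintro _ ⟨x, -, rfl⟩
    simp [norm_cantorPt]
  set d : ℝ → ℝ := fun t => infDist (exp (t * I)) (cantorPt '' S) with hd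
  have hdm : Measurable d := by
    have : Continuous d := (continuous_infDist_pt _).comp (by fun_prop)
    exact this.measurable
  have hd2 : ∀ t, d t ≤ 2 := fun t => by
    obtain ⟨x, hx⟩ := hne
    refine (infDist_le_dist_of_mem (mem_image_of_mem _ hx)).trans ?_
    rw [dist_eq_norm]
    refine (norm_sub_le _ _).trans ?_
    rw [norm_exp_ofReal_mul_I, norm_cantorPt]
    norm_num
  refine ⟨(by fun_prop : Measurable fun t => Real.log (2 / d t)).aestronglyMeasurable, ?_⟩
  have hbound : ∀ t ∈ Ioc (-Real.pi) Real.pi, ‖Real.log (2 / d t)‖ₑ ≤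
      1 + 2 * ∑' m, (cantorNhd m).indicator 1 t := by
    intro t ht
    rcases (infDist_nonneg : 0 ≤ d t).eq_or_lt with h0 | h0
    · have h1 : d t = 0 := h0.symm
      rw [h1]
      simp
    have hlog : 0 ≤ Real.log (2 / d t) := Real.log_nonneg (by rw [le_div_iff₀ h0]; linarith [hd2 t])
    rw [Real.enorm_eq_ofReal hlog]
    have hl2 : Real.log 2 ≤ 1 := by linarith [Real.log_two_lt_d9]
    rcases le_total 1 (d t) with h1 | h1
    · refine le_trans ?_ le_self_add
      rw [← ENNReal.ofReal_one]
      refine ENNReal.ofReal_le_ofReal ((Real.log_le_log (by positivity) ?_).trans hl2)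
      rw [div_le_iff₀ h0]; linarith
    · obtain ⟨n, hn1, hn2⟩ := exists_nat_pow_near_of_lt_one h0 h1
        (show (0 : ℝ) < 2 / 9 by norm_num) (by norm_num)
      obtain ⟨_, ⟨x, hx, rfl⟩, hxd⟩ := hK.exists_infDist_eq_dist hKne (exp (t * I))
      have hmem : ∀ k ∈ Finset.range (n + 1), (cantorNhd k).indicator (1 : ℝ → ENNReal) t = 1 := by
        intro k hk
        refine Set.indicator_of_mem (mem_cantorNhd ht (x := x) ?_) _
        rw [← dist_eq_norm, ← hxd]
        refine (hn2.trans (pow_le_pow_of_le_one (by norm_num) (by norm_num)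
          (Nat.lt_succ_iff.1 (Finset.mem_range.1 hk)))).trans ?_
        have : (0 : ℝ) < (2 / 9) ^ k := by positivity
        linarith
      have hsum : ((n + 1 : ℕ) : ENNReal) ≤ ∑' m, (cantorNhd m).indicator (1 : ℝ → ENNReal) t := by
        refine le_trans (le_of_eq ?_) (ENNReal.sum_le_tsum (Finset.range (n + 1)))
        rw [Finset.sum_congr rfl hmem]
        simp
      refine le_trans ?_ (add_le_add le_rfl (mul_le_mul_right hsum 2))
      have hlog9 : Real.log (9 / 2) ≤ 2 := by
        rw [Real.log_le_iff_le_exp (by norm_num), show (2 : ℝ) = 1 + 1 by norm_num, Real.exp_add]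
        nlinarith [Real.exp_one_gt_d9]
      have hle : Real.log (2 / d t) ≤ 1 + 2 * ((n + 1 : ℕ) : ℝ) := by
        have h3 : 2 / d t ≤ 2 * (9 / 2) ^ (n + 1) := by
          rw [div_le_iff₀ h0]
          have : (9 / 2 : ℝ) ^ (n + 1) * (2 / 9) ^ (n + 1) = 1 := by
            rw [← mul_pow]; norm_num
          have h4 : (0 : ℝ) < (9 / 2) ^ (n + 1) := by positivity
          nlinarith
        refine (Real.log_le_log (by positivity) h3).trans ?_
        rw [Real.log_mul (by norm_num) (by positivity), Real.log_pow]
        have : (0 : ℝ) ≤ ((n + 1 : ℕ) : ℝ) := by positivity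
        nlinarith
      refine (ENNReal.ofReal_le_ofReal hle).trans ?_
      rw [ENNReal.ofReal_add (by norm_num) (by positivity), ENNReal.ofReal_mul (by norm_num),
        ENNReal.ofReal_natCast]
      simp
  refine (setLIntegral_mono' measurableSet_Ioc hbound).trans_lt ?_
  have hmeas : ∀ m, Measurable ((cantorNhd m).indicator (1 : ℝ → ENNReal)) := fun m =>
    measurable_one.indicator (measurableSet_cantorNhd m)
  rw [lintegral_add_left measurable_const, lintegral_const_mul _ (Measurable.tsum hmeas),
    lintegral_tsum fun m => (hmeas m).aemeasurable]
  refine ENNReal.add_lt_top.2 ⟨by simp, ENNReal.mul_lt_top (by simp) ?_⟩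
  have hs : Summable fun m : ℕ => 18 * (4 / 9 : ℝ) ^ m :=
    (summable_geometric_of_lt_one (by norm_num) (by norm_num)).mul_left 18
  refine lt_of_le_of_lt (ENNReal.tsum_le_tsum fun m => ?_) (hs.tsum_ofReal_lt_top)
  rw [lintegral_indicator_one (measurableSet_cantorNhd m)]
  exact (Measure.restrict_apply_le _ _).trans (volume_cantorNhd_le m)

theorem VanishAllDeriv.exists_lipschitz {E : Set ℂ} {g : ℂ → ℂ} (hg : VanishAllDeriv E g) :
    ∃ L : ℝ, ∀ z w, ‖z‖ ≤ 1 → ‖w‖ ≤ 1 → ‖g z - g w‖ ≤ L * ‖z - w‖ := by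
  obtain ⟨hc, hd, -, hn⟩ := hg
  obtain ⟨G, hG, hGe, -⟩ := hn 1
  obtain ⟨L, hL⟩ := (isCompact_closedBall (0 : ℂ) 1).exists_bound_of_continuousOn hG
  have hL0 : 0 ≤ L := (norm_nonneg _).trans (hL 0 (by simp))
  lift L to NNReal using hL0
  have h1 : LipschitzOnWith L g (ball 0 1) := by
    refine (convex_ball 0 1).lipschitzOnWith_of_nnnorm_deriv_le (𝕜 := ℂ)
      (fun z hz => (hd z hz).differentiableAt (isOpen_ball.mem_nhds hz)) fun z hz => ?_
    rw [← NNReal.coe_le_coe, coe_nnnorm, ← iteratedDeriv_one, ← hGe hz]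
    exact hL z (ball_subset_closedBall hz)
  rw [← lipschitzOnWith_closure_iff (by rwa [closure_ball _ one_ne_zero]),
    closure_ball _ one_ne_zero] at h1
  refine ⟨L, fun z w hz hw => ?_⟩
  have := h1.dist_le_mul z (by simpa using hz) w (by simpa using hw)
  rwa [dist_eq_norm, dist_eq_norm] at this

theorem J0Plus_subset_IPlus {K : Set ℂ} (hK : K ⊆ closedBall 0 1) : J0Plus K ⊆ IPlus K := by
  rintro f ⟨hf, happ⟩
  refine ⟨hf, fun z hz => norm_le_zero_iff.1 (le_of_forall_pos_lt_add fun ε hε => ?_)⟩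
  obtain ⟨g, hg, hgK, hfg⟩ := happ ε hε
  have := norm_le_APlusNorm (sub_mem_APlus hf hg) (z := z) (by simpa using hK hz)
  rw [Pi.sub_apply, hgK.2.2.1 z hz, sub_zero] at this
  linarith

namespace IsThinSequence

variable {H : ℕ → C(ℕ → Bool, Circle)} {u : ℕ → C(ℕ → Bool, ℂ)} {m : ℕ → ℕ} {ε : ℕ → ℝ}

theorem bound_nonneg (hu : IsThinSequence H u m ε) : 0 ≤ ε 0 + ‖u 0‖ :=
  add_nonneg (hu.eps_pos 0).le (norm_nonneg _)

theorem limitPairing_mul_eq_zero_of_approx (hu : IsThinSequence H u m ε) {f w : ℂ → ℂ}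
    (hf : f ∈ APlus) (hw : w ∈ APlus)
    (happ : ∀ δ > 0, ∃ g ∈ APlus, limitPairing u (g * w) = 0 ∧ APlusNorm (f - g) < δ) :
    limitPairing u (f * w) = 0 := by
  have hB : 0 ≤ (ε 0 + ‖u 0‖) * APlusNorm w := mul_nonneg hu.bound_nonneg (APlusNorm_nonneg _)
  refine norm_le_zero_iff.1 (le_of_forall_pos_lt_add fun δ hδ => ?_)
  obtain ⟨g, hg, hg0, hfg⟩ := happ (δ / ((ε 0 + ‖u 0‖) * APlusNorm w + 1)) (by positivity)
  have h1 : limitPairing u (f * w) = limitPairing u ((f - g) * w) := by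
    have := hu.limitPairing_sub (mul_mem_APlus hf hw) (mul_mem_APlus hg hw)
    rw [hg0, sub_zero] at this
    rw [← this]
    congr 1
    ext z
    simp [sub_mul]
  have h2 := hu.norm_limitPairing_le (mul_mem_APlus (sub_mem_APlus hf hg) hw)
  have h3 := APlusNorm_mul_le (sub_mem_APlus hf hg) hw
  rw [lt_div_iff₀ (by linarith)] at hfg
  rw [h1]
  have h4 := mul_le_mul_of_nonneg_left h3 hu.bound_nonneg
  have h5 := APlusNorm_nonneg (f - g)
  nlinarith

theorem limitPairing_mul_eq_zero_of_mem_J0Plus (hu : IsThinSequence H u m ε) {f w : ℂ → ℂ}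
    (hf : f ∈ J0Plus (cantorPt '' limitSupport u)) (hw : w ∈ APlus) :
    limitPairing u (f * w) = 0 := by
  refine hu.limitPairing_mul_eq_zero_of_approx hf.1 hw fun δ hδ => ?_
  obtain ⟨g, hg, hgK, hfg⟩ := hf.2 δ hδ
  obtain ⟨L, hL⟩ := hgK.exists_lipschitz
  exact ⟨g, hg, hu.limitPairing_mul_eq_zero hg hw hL
    fun x hx => hgK.2.2.1 _ (mem_image_of_mem _ hx), hfg⟩

theorem exists_mem_IPlus (hu : IsThinSequence H u m ε) {K : Set ℂ} (hK : HasPowerApprox K)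
    (hK1 : K ⊆ closedBall 0 1) {w : ℂ → ℂ} (hw : w ∈ APlus) (hw0 : limitPairing u w ≠ 0) :
    ∃ f ∈ IPlus K, limitPairing u (f * w) ≠ 0 := by
  set c := ‖limitPairing u w‖ with hc
  have hc0 : 0 < c := norm_pos_iff.2 hw0
  set B := (ε 0 + ‖u 0‖) * APlusNorm w with hB
  have hB0 : 0 ≤ B := mul_nonneg hu.bound_nonneg (APlusNorm_nonneg _)
  obtain ⟨M, hM⟩ := eventually_atTop.1 ((hu.limitPairing_mul_pow_tendsto hw).norm.eventually
    (gt_mem_nhds (show ‖(0 : ℂ)‖ < c / 4 by rw [norm_zero]; linarith)))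
  set η := c / (16 * (B + 1)) with hη
  have hη0 : 0 < η := by positivity
  obtain ⟨N, hN, hNK⟩ := hK (fun _ => 1) continuousOn_const (fun _ _ => norm_one) η hη0 M
  obtain ⟨F, hF, hFn, hFK⟩ := hK.exists_interpolation hK1 (g := fun z => 1 - z ^ N) hη0
    (by fun_prop) fun z hz => (hNK z hz).le
  have h1 := const_mem_APlus 1
  have hp := pow_mem_APlus N
  have h1p := sub_mem_APlus h1 hp
  refine ⟨((fun _ => 1) - fun z => z ^ N) - F, ⟨sub_mem_APlus h1p hF, fun z hz => ?_⟩, fun h0 => ?_⟩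
  · simp [hFK z hz]
  have hwp := mul_mem_APlus hw hp
  have hFw := mul_mem_APlus hF hw
  have hsplit : limitPairing u ((((fun _ => 1) - fun z => z ^ N) - F) * w) =
      limitPairing u w - limitPairing u (fun z => w z * z ^ N) - limitPairing u (F * w) := by
    refine Eq.trans ?_ ((hu.limitPairing_sub (sub_mem_APlus hw hwp) hFw).trans
      (congrArg (· - limitPairing u (F * w)) (hu.limitPairing_sub hw hwp)))
    congr 1
    ext z
    simp only [Pi.mul_apply, Pi.sub_apply]
    ring
  rw [h0] at hsplit
  have h2 : limitPairing u w = limitPairing u (fun z => w z * z ^ N) + limitPairing u (F * w) := by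
    linear_combination -hsplit
  have h3 : c ≤ ‖limitPairing u (fun z => w z * z ^ N)‖ + ‖limitPairing u (F * w)‖ := by
    rw [hc, h2]
    exact norm_add_le _ _
  have h4 := hM N hN
  have h5 : ‖limitPairing u (F * w)‖ ≤ 4 * η * B := by
    refine (hu.norm_limitPairing_le hFw).trans ?_
    have h6 := (APlusNorm_mul_le hF hw).trans
      (mul_le_mul_of_nonneg_right hFn (APlusNorm_nonneg w))
    refine (mul_le_mul_of_nonneg_left h6 hu.bound_nonneg).trans_eq ?_
    rw [hB]
    ring
  have h7 : η * (16 * (B + 1)) = c := div_mul_cancel₀ _ (by positivity)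
  linarith

theorem exists_disjoint_step (hu : IsThinSequence H u m ε) {j : ℕ} {x : ℕ → Bool}
    (hx : u j x ≠ 0) : ∃ x', u (j + 1) x' ≠ 0 ∧ ∃ e v : ℂ → ℂ, e ∈ APlus ∧ v ∈ APlus ∧
      PiNat.cylinder x' (m (j + 1)) ⊆ PiNat.cylinder x (m j) ∧
      (∀ y ∉ PiNat.cylinder x (m j), e (cantorPt y) = 0) ∧
      (∀ y ∈ PiNat.cylinder x' (m (j + 1)), e (cantorPt y) = 0) ∧
      limitPairing u (fun z => e z * e z * v z) ≠ 0 := by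
  obtain ⟨-, -, -, -, -, -, h⟩ := hu.exists_localized hx
  obtain ⟨y, hy, hy0⟩ := h (j + 1) (Nat.le_succ j)
  obtain ⟨x', hx', hx0, hxy⟩ := (hu.thinning j).split y hy0
  obtain ⟨e, he, v, hv, h1, h2, -⟩ := hu.exists_localized hy0
  have hm : m j ≤ m (j + 1) := by
    by_contra! hlt
    exact hxy (PiNat.cylinder_anti _ hlt.le hx')
  have e1 : PiNat.cylinder y (m j) = PiNat.cylinder x (m j) := PiNat.mem_cylinder_iff_eq.1 hy
  have e2 : PiNat.cylinder x' (m j) = PiNat.cylinder x (m j) :=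
    (PiNat.mem_cylinder_iff_eq.1 hx').trans e1
  refine ⟨x', hx0, e, v, he, hv, e2 ▸ PiNat.cylinder_anti _ hm,
    fun z hz => h1 z fun hzy => hz (e1 ▸ PiNat.cylinder_anti _ hm hzy), fun z hz => h1 z fun hzy => ?_,
    h2⟩
  rw [← PiNat.mem_cylinder_iff_eq.1 hzy, PiNat.mem_cylinder_iff_eq.1 hz] at hxy
  exact hxy (PiNat.self_mem_cylinder _ _)

theorem exists_orthogonal_family (hu : IsThinSequence H u m ε) :
    ∃ e v : ℕ → ℂ → ℂ, (∀ i, e i ∈ APlus) ∧ (∀ i, v i ∈ APlus) ∧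
      (∀ i k, i ≠ k → ∀ x, e i (cantorPt x) * e k (cantorPt x) = 0) ∧
      ∀ i, limitPairing u (fun z => e i z * e i z * v i z) ≠ 0 := by
  obtain ⟨x₀, hx₀⟩ := hu.nontrivial
  have step : ∀ (j : ℕ) (x : {x // u j x ≠ 0}), ∃ x' : {x // u (j + 1) x ≠ 0},
      ∃ e v : ℂ → ℂ, e ∈ APlus ∧ v ∈ APlus ∧
      PiNat.cylinder x'.1 (m (j + 1)) ⊆ PiNat.cylinder x.1 (m j) ∧
      (∀ y ∉ PiNat.cylinder x.1 (m j), e (cantorPt y) = 0) ∧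
      (∀ y ∈ PiNat.cylinder x'.1 (m (j + 1)), e (cantorPt y) = 0) ∧
      limitPairing u (fun z => e z * e z * v z) ≠ 0 := fun j x => by
    obtain ⟨x', h, h'⟩ := hu.exists_disjoint_step x.2
    exact ⟨⟨x', h⟩, h'⟩
  choose next e v he hv hsub hoff hon hne using step
  let t : (j : ℕ) → {x // u j x ≠ 0} := fun j => Nat.rec ⟨x₀, hx₀⟩ next j
  have hanti : Antitone fun j => PiNat.cylinder (t j).1 (m j) :=
    antitone_nat_of_succ_le fun j => hsub j (t j)
  have hlt : ∀ i k, i < k → ∀ x, e i (t i) (cantorPt x) * e k (t k) (cantorPt x) = 0 := by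
    intro i k hik x
    by_cases hx : x ∈ PiNat.cylinder (t k).1 (m k)
    · rw [hon i (t i) x (hanti (Nat.succ_le_of_lt hik) hx), zero_mul]
    · rw [hoff k (t k) x hx, mul_zero]
  refine ⟨fun i => e i (t i), fun i => v i (t i), fun i => he _ _, fun i => hv _ _,
    fun i k hik x => ?_, fun i => hne _ _⟩
  rcases hik.lt_or_gt with h | h
  · exact hlt i k h x
  · rw [mul_comm]; exact hlt k i h x

end IsThinSequence

/-- Functions vanishing on `K` and annihilated by the functionals `f ↦ limitPairing u (f * e i * g)`
for `i ∈ s`. -/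
def annihilatorIdeal (u : ℕ → C(ℕ → Bool, ℂ)) (e : ℕ → ℂ → ℂ) (K : Set ℂ) (s : Set ℕ) :
    Set (ℂ → ℂ) :=
  {f | f ∈ IPlus K ∧ ∀ i ∈ s, ∀ g ∈ APlus, limitPairing u (f * (e i * g)) = 0}

namespace IsThinSequence

variable {H : ℕ → C(ℕ → Bool, Circle)} {u : ℕ → C(ℕ → Bool, ℂ)} {m : ℕ → ℕ} {ε : ℕ → ℝ}

theorem isClosedIdeal_annihilatorIdeal (hu : IsThinSequence H u m ε) {e : ℕ → ℂ → ℂ}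
    (he : ∀ i, e i ∈ APlus) {K : Set ℂ} (hK1 : K ⊆ closedBall 0 1) (s : Set ℕ) :
    IsClosedIdealAPlus (annihilatorIdeal u e K s) := by
  refine ⟨fun f hf => hf.1.1, fun f hf g hg => ⟨⟨add_mem_APlus hf.1.1 hg.1.1, fun z hz => ?_⟩,
    fun i hi w hw => ?_⟩, fun f hf g hg => ⟨⟨mul_mem_APlus hf hg.1.1, fun z hz => ?_⟩,
    fun i hi w hw => ?_⟩, fun f hf happ => ⟨⟨hf, fun z hz => ?_⟩, fun i hi w hw => ?_⟩⟩
  · rw [Pi.add_apply, hf.1.2 z hz, hg.1.2 z hz, add_zero]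
  · have hew := mul_mem_APlus (he i) hw
    rw [add_mul]
    refine (hu.limitPairing_add (mul_mem_APlus hf.1.1 hew) (mul_mem_APlus hg.1.1 hew)).trans ?_
    rw [hf.2 i hi w hw, hg.2 i hi w hw, add_zero]
  · rw [Pi.mul_apply, hg.1.2 z hz, mul_zero]
  · rw [show f * g * (e i * w) = g * (e i * (f * w)) by ring]
    exact hg.2 i hi _ (mul_mem_APlus hf hw)
  · refine norm_le_zero_iff.1 (le_of_forall_pos_lt_add fun δ hδ => ?_)
    obtain ⟨g, hg, hfg⟩ := happ δ hδ
    have := norm_le_APlusNorm (sub_mem_APlus hf hg.1.1) (z := z) (by simpa using hK1 hz)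
    rw [Pi.sub_apply, hg.1.2 z hz, sub_zero] at this
    linarith
  · refine hu.limitPairing_mul_eq_zero_of_approx hf (mul_mem_APlus (he i) hw) fun δ hδ => ?_
    obtain ⟨g, hg, hfg⟩ := happ δ hδ
    exact ⟨g, hg.1.1, hg.2 i hi w hw, hfg⟩

theorem annihilatorIdeal_subset_imp (hu : IsThinSequence H u m ε) {e v : ℕ → ℂ → ℂ}
    (he : ∀ i, e i ∈ APlus) (hv : ∀ i, v i ∈ APlus)
    (horth : ∀ i k, i ≠ k → ∀ x, e i (cantorPt x) * e k (cantorPt x) = 0)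
    (hne : ∀ i, limitPairing u (fun z => e i z * e i z * v i z) ≠ 0)
    {K : Set ℂ} (hK : HasPowerApprox K) (hK1 : K ⊆ closedBall 0 1) {s t : Set ℕ}
    (hst : annihilatorIdeal u e K s ⊆ annihilatorIdeal u e K t) : t ⊆ s := by
  intro i hit
  by_contra his
  obtain ⟨f, hf, hf0⟩ := hu.exists_mem_IPlus hK hK1 (mul_mul_mem_APlus (he i) (hv i)) (hne i)
  have hfe := mul_mem_APlus hf.1 (he i)
  have hmem : f * e i ∈ annihilatorIdeal u e K s := by
    refine ⟨⟨hfe, fun z hz => ?_⟩, fun k hk g hg => ?_⟩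
    · rw [Pi.mul_apply, hf.2 z hz, zero_mul]
    · refine hu.limitPairing_eq_zero (mul_mem_APlus hfe (mul_mem_APlus (he k) hg)) fun x => ?_
      have := horth i k (fun h => his (h ▸ hk)) x
      simp only [Pi.mul_apply]
      linear_combination f (cantorPt x) * g (cantorPt x) * this
  refine hf0 ?_
  rw [← (hst hmem).2 i hit (v i) (hv i)]
  congr 1
  ext z
  simp only [Pi.mul_apply]
  ring

end IsThinSequence

theorem HasPowerApprox.isKronecker {K : Set ℂ} (hK : HasPowerApprox K) (hc : IsCompact K)
    (h1 : K ⊆ sphere 0 1) : IsKronecker K := by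
  refine ⟨hc, h1, fun f hf hf1 ε hε => ?_⟩
  obtain ⟨n, -, hn⟩ := hK f hf hf1 ε hε 0
  exact ⟨n, fun z hz => by simpa using hn z hz⟩

/-- There is a compact set `K` which is both Kronecker and Carleson such
that `J₀⁺(K) ⊊ I⁺(K)`, and there are `2^ℵ₀` distinct closed ideals of `A⁺` between
`J₀⁺(K)` and `I⁺(K)`. -/
theorem stmt_13 :
    ∃ K : Set ℂ, IsKronecker K ∧ IsCarleson K ∧
      J0Plus K ⊆ IPlus K ∧ J0Plus K ≠ IPlus K ∧
      ∃ F : Set ℕ → Set (ℂ → ℂ), Function.Injective F ∧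
        ∀ s : Set ℕ, IsClosedIdealAPlus (F s) ∧ J0Plus K ⊆ F s ∧ F s ⊆ IPlus K := by
  obtain ⟨H, hH⟩ := exists_circle_sequence
  obtain ⟨u, m, ε, hu⟩ := exists_isThinSequence H
  obtain ⟨e, v, he, hv, horth, hne⟩ := hu.exists_orthogonal_family
  have hcl := IsThinSequence.isClosed_limitSupport u
  have hK := hu.hasPowerApprox hH
  have hC := isCarleson_cantorPt_image hcl hu.limitSupport_nonempty
  have hK1 := hC.2.1.trans sphere_subset_closedBall
  have hsub := J0Plus_subset_IPlus hK1
  have himp : ∀ {s t : Set ℕ}, annihilatorIdeal u e (cantorPt '' limitSupport u) s ⊆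
      annihilatorIdeal u e (cantorPt '' limitSupport u) t → t ⊆ s :=
    hu.annihilatorIdeal_subset_imp he hv horth hne hK hK1
  have hJ : ∀ s, J0Plus (cantorPt '' limitSupport u) ⊆
      annihilatorIdeal u e (cantorPt '' limitSupport u) s := fun s f hf =>
    ⟨hsub hf, fun i _ g hg => hu.limitPairing_mul_eq_zero_of_mem_J0Plus hf (mul_mem_APlus (he i) hg)⟩
  refine ⟨cantorPt '' limitSupport u,
    hK.isKronecker (hcl.isCompact.image continuous_cantorPt) hC.2.1, hC, hsub, fun h => ?_,
    annihilatorIdeal u e _, fun s t hst => (himp hst.ge).antisymm (himp hst.le),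
    fun s => ⟨hu.isClosedIdeal_annihilatorIdeal he hK1 s, hJ s, fun f hf => hf.1⟩⟩
  have h0 : annihilatorIdeal u e (cantorPt '' limitSupport u) ∅ ⊆
      annihilatorIdeal u e (cantorPt '' limitSupport u) univ := fun f hf =>
    hJ univ (h ▸ hf.1)
  exact himp h0 (mem_univ 0)
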